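/- arXiv:math/0008002 — 3 statements merged into one kernel-verified Lean document; each statement's English description precedes it below -/
import Mathlib

section
/- Let k be a field, n ≥ 3, F = X_1^{d_1} + ... + X_n^{d_n}, Z = V(F) ⊂ A^n, with Z smooth away from the origin, and suppose ∑_{i=1}^n 1/d_i > 1. Then for every m ≥ 1 with d_1···d_n dividing m+1, dim π_m^{-1}(0) < (m+1)(n−1), and hence Z_m is irreducible for every m ≥ 1. -/
noncomputable section

/-- The universal substitution `U_i ↦ ∑_j X_{i,j} t^j` computing the equations of jet schemes:
a polynomial `f` in the variables `σ` is sent to a polynomial in `t` whose coefficients are the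
equations of the jet scheme of `V(f)`. -/
def jetSub (k : Type*) [CommRing k] (σ : Type*) (m : ℕ) :
    MvPolynomial σ k →ₐ[k] Polynomial (MvPolynomial (σ × Fin (m + 1)) k) :=
  MvPolynomial.aeval fun i =>
    ∑ j : Fin (m + 1), Polynomial.C (MvPolynomial.X (i, j)) * Polynomial.X ^ (j : ℕ)

/-- The ideal of the `m`-th jet scheme of the closed subscheme of affine space `Spec k[σ]`
defined by the equations in `F`: it is generated by the coefficients of `t^l`, `0 ≤ l ≤ m`,
of the universal substitutions of the elements of `F`. -/
def jetIdeal (k : Type*) [CommRing k] (σ : Type*) (m : ℕ)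
    (F : Set (MvPolynomial σ k)) : Ideal (MvPolynomial (σ × Fin (m + 1)) k) :=
  Ideal.span {g | ∃ f ∈ F, ∃ l ≤ m, g = Polynomial.coeff (jetSub k σ m f) l}

/-- The ideal of the fiber `π_m⁻¹(x)` of the `m`-th jet scheme over the point `x`. -/
def jetFiberIdeal (k : Type*) [CommRing k] (σ : Type*) (m : ℕ)
    (F : Set (MvPolynomial σ k)) (x : σ → k) : Ideal (MvPolynomial (σ × Fin (m + 1)) k) :=
  jetIdeal k σ m F ⊔
    Ideal.span (Set.range fun i : σ =>
      MvPolynomial.X (i, (0 : Fin (m + 1))) - MvPolynomial.C (x i))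

/-- The ideal of the locus `π_m⁻¹(Z)` of `m`-jets lying over the closed subscheme `Z = V(G)`. -/
def jetOverIdeal (k : Type*) [CommRing k] (σ : Type*) (m : ℕ)
    (F G : Set (MvPolynomial σ k)) : Ideal (MvPolynomial (σ × Fin (m + 1)) k) :=
  jetIdeal k σ m F ⊔
    Ideal.span ((MvPolynomial.rename fun i : σ => (i, (0 : Fin (m + 1)))) '' G)

/-- The Zariski tangent space at a point `x` of the subvariety of affine space cut out by the
equations `F`, namely the common kernel of the differentials at `x`. -/
def tangentSpaceAt (k : Type*) [Field k] {σ : Type*} [Fintype σ]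
    (F : Set (MvPolynomial σ k)) (x : σ → k) : Submodule k (σ → k) :=
  ⨅ f ∈ F, LinearMap.ker (∑ i : σ,
    MvPolynomial.eval x (MvPolynomial.pderiv i f) •
      (LinearMap.proj i : (σ → k) →ₗ[k] k))

open Polynomial in
lemma Ideal.height_ker_le_height_ker_eval₂ {A K : Type*} [CommRing A] [IsNoetherianRing A]
    [CommRing K] [IsDomain K] (f : A →+* K) (x : K) :
    (RingHom.ker f).height ≤ (RingHom.ker (eval₂RingHom f x)).height := by
  have : (RingHom.ker (eval₂RingHom f x)).LiesOver (RingHom.ker f) :=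
    ⟨by ext a; simp [RingHom.mem_ker, Ideal.mem_comap, Ideal.under]⟩
  have : (RingHom.ker f).IsPrime := RingHom.ker_isPrime f
  have : (RingHom.ker (eval₂RingHom f x)).IsPrime := RingHom.ker_isPrime _
  rw [Ideal.height_eq_height_add_of_liesOver_of_hasGoingDown (RingHom.ker f)
    (RingHom.ker (eval₂RingHom f x))]
  exact le_self_add

open Polynomial in
lemma Ideal.height_ker_add_one_le_height_ker_eval₂ {A K : Type*} [CommRing A] [IsNoetherianRing A]
    [CommRing K] [IsDomain K] (f : A →+* K) (x : K) (q : A[X]) (hq : q.eval₂ f x = 0)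
    (hq' : q.map f ≠ 0) :
    (RingHom.ker f).height + 1 ≤ (RingHom.ker (eval₂RingHom f x)).height := by
  have : (RingHom.ker f).IsPrime := RingHom.ker_isPrime f
  have : (RingHom.ker (eval₂RingHom f x)).IsPrime := RingHom.ker_isPrime _
  have hker : (RingHom.ker f).map C = RingHom.ker (mapRingHom f) := (ker_mapRingHom f).symm
  have : ((RingHom.ker f).map C).IsPrime := hker ▸ RingHom.ker_isPrime _
  have hlo : ((RingHom.ker f).map (C : A →+* A[X])).LiesOver (RingHom.ker f) := by
    refine ⟨?_⟩
    rw [hker]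
    ext a
    simp [RingHom.mem_ker, Ideal.mem_comap, Ideal.under]
  have hlt : (RingHom.ker f).map C < RingHom.ker (eval₂RingHom f x) := by
    refine lt_of_le_of_ne ?_ fun h ↦ hq' ?_
    · rw [Ideal.map_le_iff_le_comap]
      intro a ha
      simpa [RingHom.mem_ker, Ideal.mem_comap] using ha
    · have : q ∈ RingHom.ker (eval₂RingHom f x) := by simpa [RingHom.mem_ker] using hq
      rw [← h, hker] at this
      simpa [RingHom.mem_ker] using this
  refine le_trans ?_ (Ideal.height_add_one_le_of_lt_of_isPrime hlt)
  gcongr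
  rw [Ideal.height_eq_height_add_of_liesOver_of_hasGoingDown (RingHom.ker f)
    ((RingHom.ker f).map C)]
  exact le_self_add

open AlgebraicIndependent in
lemma MvPolynomial.card_le_height_ker_add_eRk {k K σ : Type*} [Field k] [Field K] [Algebra k K]
    [Finite σ] (x : σ → K) :
    (Nat.card σ : ℕ∞) ≤ (RingHom.ker (aeval (R := k) x)).height +
      (matroid k K).eRk (Set.range x) := by
  induction σ using Finite.induction_empty_option with
  | of_equiv e H =>
    have h := H (x ∘ e)
    rw [Nat.card_congr e, EquivLike.range_comp] at h
    have hk : RingHom.ker (aeval (R := k) (x ∘ e)) =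
        (RingHom.ker (aeval (R := k) x)).comap (renameEquiv k e).toRingEquiv := by
      ext p
      simp [RingHom.mem_ker, Ideal.mem_comap, aeval_rename]
    rwa [hk, RingEquiv.height_comap] at h
  | h_empty => simp
  | @h_option σ _ IH =>
    have h := IH (x ∘ some)
    have hr : Set.range x = insert (x none) (Set.range (x ∘ some)) := by
      ext y; simp [Option.exists, eq_comm]
    have hk : RingHom.ker (aeval (R := k) x) =
        (RingHom.ker (Polynomial.eval₂RingHom (aeval (R := k) (x ∘ some)).toRingHom
          (x none))).comap (optionEquivLeft k σ).toRingEquiv := by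
      have : ((Polynomial.eval₂RingHom (aeval (R := k) (x ∘ some)).toRingHom
          (x none))).comp (optionEquivLeft k σ).toRingEquiv.toRingHom =
          (aeval (R := k) x).toRingHom := by
        refine MvPolynomial.ringHom_ext (fun r ↦ ?_) fun i ↦ ?_
        · simp [optionEquivLeft_C]
        · cases i <;> simp [optionEquivLeft_X_none, optionEquivLeft_X_some]
      ext p
      rw [Ideal.mem_comap, RingHom.mem_ker, RingHom.mem_ker]
      exact (congrArg (· = 0) (RingHom.congr_fun this p)).to_iff.symm
    rw [hk, RingEquiv.height_comap, hr]
    have hcard : (Nat.card (Option σ) : ℕ∞) = Nat.card σ + 1 := by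
      rw [Finite.card_option]; push_cast; rfl
    rw [hcard]
    by_cases hx : x none ∈ (matroid k K).closure (Set.range (x ∘ some))
    · have hrk : (matroid k K).eRk (insert (x none) (Set.range (x ∘ some))) =
          (matroid k K).eRk (Set.range (x ∘ some)) := by
        rw [← Matroid.eRk_closure_eq, Matroid.closure_insert_eq_of_mem_closure hx,
          Matroid.eRk_closure_eq]
      rw [matroid_closure_eq, SetLike.mem_coe, Subalgebra.mem_algebraicClosure,
        Algebra.adjoin_range_eq_range_aeval] at hx
      obtain ⟨p, hp0, hp⟩ := hx
      obtain ⟨q, rfl⟩ := Polynomial.map_surjective _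
        (AlgHom.rangeRestrict_surjective (aeval (R := k) (x ∘ some))) p
      have hval : (algebraMap (aeval (R := k) (x ∘ some)).range K).comp
          ((aeval (R := k) (x ∘ some)).rangeRestrict : MvPolynomial σ k →+* _) =
          (aeval (R := k) (x ∘ some)).toRingHom := rfl
      rw [hrk]
      refine (add_le_add_left h 1).trans ?_
      rw [add_right_comm]
      gcongr
      refine Ideal.height_ker_add_one_le_height_ker_eval₂ _ (x none) q ?_ ?_
      · rw [← hp, Polynomial.aeval_def, Polynomial.eval₂_map]
        rfl
      · intro h0
        refine hp0 (Polynomial.map_injective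
          (algebraMap (aeval (R := k) (x ∘ some)).range K) Subtype.val_injective ?_)
        rw [Polynomial.map_map, Polynomial.map_zero]
        exact h0
    · rw [Matroid.eRk_insert_eq_add_one ⟨Set.mem_univ _, hx⟩, ← add_assoc]
      gcongr
      exact h.trans (by gcongr; exact Ideal.height_ker_le_height_ker_eval₂ _ _)

open AlgebraicIndependent in
/-- If all `x i` are algebraic over a field generated by `c` elements, the prime ideal of algebraic
relations among the `x i` has height at least the number of variables minus `c`. -/
lemma MvPolynomial.card_le_height_ker_add_card {k K σ : Type*} [Field k] [Field K] [Algebra k K]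
    [Finite σ] (x : σ → K) (B : Finset K)
    (hB : ∀ i, IsAlgebraic (Algebra.adjoin k (B : Set K)) (x i)) :
    (Nat.card σ : ℕ∞) ≤ (RingHom.ker (aeval (R := k) x)).height + B.card := by
  refine (card_le_height_ker_add_eRk (k := k) x).trans ?_
  gcongr
  calc (matroid k K).eRk (Set.range x) ≤ (matroid k K).eRk ((matroid k K).closure B) := by
        refine Matroid.eRk_mono _ ?_
        rintro _ ⟨i, rfl⟩
        rw [matroid_closure_eq]
        exact (Subalgebra.mem_algebraicClosure _ _).2 (hB i)
    _ ≤ B.card := by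
        rw [Matroid.eRk_closure_eq]
        simpa using (matroid k K).eRk_le_encard (B : Set K)

open Polynomial in
lemma Polynomial.irreducible_X_pow_add_C {R : Type*} [CommRing R] [IsDomain R] {a : ℕ}
    (ha : a ≠ 0) {q g : R} (hq : Prime q) (hqg : q ∣ g) (hqg' : ¬ q ^ 2 ∣ g) :
    Irreducible (X ^ a + C g : R[X]) := by
  have hP : (Ideal.span {q}).IsPrime := (Ideal.span_singleton_prime hq.ne_zero).2 hq
  have hmonic : (X ^ a + C g : R[X]).Monic := monic_X_pow_add_C g ha
  refine irreducible_of_eisenstein_criterion hP ?_ ?_ ?_ ?_ hmonic.isPrimitive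
  · rw [hmonic.leadingCoeff]
    exact (Ideal.ne_top_iff_one _).1 hP.ne_top
  · intro n hn
    rw [degree_X_pow_add_C (Nat.pos_of_ne_zero ha)] at hn
    have hn : n < a := by exact_mod_cast hn
    rw [coeff_add, coeff_X_pow, if_neg hn.ne, zero_add, coeff_C]
    split_ifs
    · exact Ideal.mem_span_singleton.2 hqg
    · exact zero_mem _
  · rw [degree_X_pow_add_C (Nat.pos_of_ne_zero ha)]
    exact_mod_cast Nat.pos_of_ne_zero ha
  · rw [coeff_add, coeff_X_pow, if_neg ha.symm, zero_add, coeff_C_zero,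
      Ideal.span_singleton_pow, Ideal.mem_span_singleton]
    exact hqg'

namespace MvPolynomial

lemma eval_single_sum_X_pow {k ι : Type*} [Field k] [Fintype ι] [DecidableEq ι] {d : ι → ℕ}
    (hd : ∀ i, d i ≠ 0) (j : ι) :
    eval (Pi.single j 1 : ι → k) (∑ i, X i ^ d i) = 1 := by
  rw [map_sum, Finset.sum_eq_single j]
  · simp
  · intro i _ hij
    simp [hij, hd]
  · simp

lemma exists_prime_dvd_sum_X_pow {k ι : Type*} [Field k] [Fintype ι] [DecidableEq ι] {d : ι → ℕ}
    (hd : ∀ i, d i ≠ 0) {i j : ι} (hij : i ≠ j) (hi : (d i : k) ≠ 0) :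
    ∃ q : MvPolynomial ι k, Prime q ∧ q ∣ ∑ i, X i ^ d i ∧ ¬ q ^ 2 ∣ ∑ i, X i ^ d i := by
  have h1 := eval_single_sum_X_pow (k := k) hd j
  have h0 : eval (0 : ι → k) (∑ i, X i ^ d i) = 0 := by simp [hd]
  obtain ⟨q, hq, hqG⟩ := WfDvdMonoid.exists_irreducible_factor
    (a := (∑ i, X i ^ d i : MvPolynomial ι k))
    (fun hu ↦ not_isUnit_zero (h0 ▸ hu.map (eval (0 : ι → k))))
    (fun h ↦ by rw [h, map_zero] at h1; exact zero_ne_one h1)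
  refine ⟨q, hq.prime, hqG, ?_⟩
  rintro ⟨h, hh⟩
  have hder : pderiv i (∑ i, X i ^ d i : MvPolynomial ι k) = C (d i : k) * X i ^ (d i - 1) := by
    rw [map_sum, Finset.sum_eq_single i]
    · simp
    · intro l _ hl
      simp [pderiv_X_of_ne hl]
    · simp
  have hqd : q ∣ C (d i : k) * X i ^ (d i - 1) := by
    rw [← hder, hh, pderiv_mul, pderiv_pow]
    exact ⟨2 * pderiv i q * h + q * pderiv i h, by push_cast; ring⟩
  have hqX : q ∣ X i := by
    rcases hq.prime.dvd_or_dvd hqd with h' | h'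
    · exact (hq.not_isUnit (isUnit_of_dvd_unit h' ((IsUnit.mk0 _ hi).map C))).elim
    · exact hq.prime.dvd_of_dvd_pow h'
  have hXG : X i ∣ (∑ i, X i ^ d i : MvPolynomial ι k) :=
    ((hq.associated_of_dvd (X_prime (R := k) (i := i)).irreducible hqX).symm.dvd).trans hqG
  have := map_dvd (eval (Pi.single j 1 : ι → k)) hXG
  rw [h1] at this
  simp [hij] at this

lemma irreducible_sum_X_pow {k ι : Type*} [Field k] [Fintype ι] [DecidableEq ι] {d : ι → ℕ}
    (hd : ∀ i, d i ≠ 0) (hι : 3 ≤ Fintype.card ι) {i : ι} (hi : (d i : k) ≠ 0) :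
    Irreducible (∑ i, X i ^ d i : MvPolynomial ι k) := by
  obtain ⟨l, hl⟩ : ∃ l, l ∉ ({i} : Finset ι) :=
    Finset.exists_mem_notMem_of_card_lt_card (t := Finset.univ) (s := {i}) (by
      rw [Finset.card_singleton, Finset.card_univ]; omega) |>.imp fun _ h ↦ h.2
  obtain ⟨j, hj⟩ : ∃ j, j ∉ ({i, l} : Finset ι) :=
    Finset.exists_mem_notMem_of_card_lt_card (t := Finset.univ) (s := {i, l}) (by
      have := Finset.card_le_two (a := i) (b := l)
      rw [Finset.card_univ]; omega) |>.imp fun _ h ↦ h.2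
  simp only [Finset.mem_singleton, Finset.mem_insert, not_or] at hl hj
  let e := (renameEquiv k (Equiv.optionSubtypeNe l).symm).trans
    (optionEquivLeft k {b : ι // b ≠ l})
  have he : e (∑ i, X i ^ d i) = Polynomial.X ^ d l +
      Polynomial.C (∑ i : {b : ι // b ≠ l}, X i ^ d i) := by
    rw [← (Equiv.optionSubtypeNe l).sum_comp, Fintype.sum_option]
    have h1 : ∀ x : {b : ι // b ≠ l}, (Equiv.optionSubtypeNe l).symm x = some x := fun x ↦
      Equiv.optionSubtypeNe_symm_of_ne x.2
    simp [e, h1, Equiv.optionSubtypeNe_symm_self, -Equiv.optionSubtypeNe_symm_apply]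
  rw [← MulEquiv.irreducible_iff e, he]
  obtain ⟨q, hq, hqG, hqG'⟩ := exists_prime_dvd_sum_X_pow (k := k) (ι := {b : ι // b ≠ l})
    (d := fun b ↦ d b) (fun b ↦ hd b) (i := ⟨i, Ne.symm hl⟩) (j := ⟨j, hj.2⟩)
    (fun h ↦ hj.1 (congrArg Subtype.val h).symm) hi
  exact Polynomial.irreducible_X_pow_add_C (hd l) hq hqG hqG'

lemma X_notMem_span_sum_X_pow {k ι : Type*} [Field k] [Fintype ι] [DecidableEq ι] {d : ι → ℕ}
    (hd : ∀ i, d i ≠ 0) (hirr : Irreducible (∑ i, X i ^ d i : MvPolynomial ι k)) {j l : ι}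
    (hjl : j ≠ l) : X j ∉ Ideal.span {(∑ i, X i ^ d i : MvPolynomial ι k)} := by
  rw [Ideal.mem_span_singleton]
  intro h
  have := map_dvd (eval (Pi.single l 1 : ι → k))
    (hirr.associated_of_dvd (X_prime (R := k) (i := j)).irreducible h).symm.dvd
  rw [eval_single_sum_X_pow hd] at this
  simp [hjl] at this

end MvPolynomial

namespace PowerSeries

lemma X_pow_dvd_sub_of_pow_add {R : Type*} [CommRing R] {N d : ℕ} {z w c : R⟦X⟧}
    (hz : X ^ N ∣ z ^ d + c) (hw : X ^ N ∣ w ^ d + c)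
    (hzw : constantCoeff z = constantCoeff w)
    (hu : IsUnit ((d : R) * constantCoeff w ^ (d - 1))) : X ^ N ∣ z - w := by
  have h : X ^ N ∣ z ^ d - w ^ d := by simpa using dvd_sub hz hw
  rw [← geom_sum₂_mul] at h
  refine (IsUnit.dvd_mul_left ?_).1 h
  rw [isUnit_iff_constantCoeff]
  have : ∀ i ∈ Finset.range d, constantCoeff w ^ i * constantCoeff w ^ (d - 1 - i) =
      constantCoeff w ^ (d - 1) := fun i hi ↦ by
    rw [← pow_add]; congr 1; have := Finset.mem_range.1 hi; omega
  simpa [map_sum, hzw, Finset.sum_congr rfl this] using hu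

lemma exists_X_pow_dvd_pow_add {R : Type*} [CommRing R] {d : ℕ} (c : R⟦X⟧) (u : R)
    (hc : u ^ d + constantCoeff c = 0) (hu : IsUnit ((d : R) * u ^ (d - 1))) (N : ℕ) :
    ∃ z : R⟦X⟧, constantCoeff z = u ∧ X ^ N ∣ z ^ d + c := by
  suffices ∃ z : R⟦X⟧, constantCoeff z = u ∧ X ^ (N + 1) ∣ z ^ d + c by
    obtain ⟨z, hz, h⟩ := this
    exact ⟨z, hz, (pow_dvd_pow _ N.le_succ).trans h⟩
  induction N with
  | zero => exact ⟨C u, by simp, by simpa [X_dvd_iff] using hc⟩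
  | succ N ih =>
    obtain ⟨z, hz, r, hr⟩ := ih
    obtain ⟨v, hv⟩ := hu
    obtain ⟨t, ht⟩ := Polynomial.powAddExpansion z (C (-(↑v⁻¹ : R) * constantCoeff r) * X ^ (N + 1)) d
    refine ⟨z + C (-(↑v⁻¹ : R) * constantCoeff r) * X ^ (N + 1), by simp [hz], ?_⟩
    have hdvd : (X : R⟦X⟧) ∣ r + (d : R⟦X⟧) * z ^ (d - 1) * C (-(↑v⁻¹ : R) * constantCoeff r) := by
      rw [X_dvd_iff]
      have : (d : R) * u ^ (d - 1) * (-(↑v⁻¹ : R) * constantCoeff r) = - constantCoeff r := by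
        rw [← hv, neg_mul, mul_neg, Units.mul_inv_cancel_left]
      simp only [map_add, map_mul, map_pow, hz, map_natCast, constantCoeff_C]
      rw [this, add_neg_cancel]
    obtain ⟨s, hs⟩ := hdvd
    refine ⟨s + (t : R⟦X⟧) * C (-(↑v⁻¹ : R) * constantCoeff r) ^ 2 * X ^ N, ?_⟩
    rw [ht]
    linear_combination hr + X ^ (N + 1) * hs

/-- The coefficients of a `d`-th root modulo `X ^ N` of a power series over `E` lie in `E`,
if `E` is a subring closed under inverses and roots. -/
lemma coeff_mem_of_X_pow_dvd_pow_add {K : Type*} [Field K] (E : Subring K)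
    (hinv : ∀ x ∈ E, x⁻¹ ∈ E) (hroot : ∀ x, ∀ d ≠ 0, x ^ d ∈ E → x ∈ E)
    {d N : ℕ} (hd : (d : K) ≠ 0) {y c : K⟦X⟧} (hy : constantCoeff y ≠ 0)
    (hc : c ∈ (map E.subtype).range) (h : X ^ N ∣ y ^ d + c) {j : ℕ} (hj : j < N) :
    coeff j y ∈ E := by
  obtain ⟨c, rfl⟩ := hc
  have hd0 : d ≠ 0 := by rintro rfl; simp at hd
  have h0 : constantCoeff y ^ d + constantCoeff c = 0 := by
    have := X_dvd_iff.1 ((dvd_pow_self X (by omega : N ≠ 0)).trans h)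
    rw [map_add, map_pow, ← coeff_zero_eq_constantCoeff_apply (map E.subtype c), coeff_map] at this
    simpa using this
  have hyE : constantCoeff y ∈ E := hroot _ d hd0 <| by
    rw [eq_neg_of_add_eq_zero_left h0]
    exact neg_mem (constantCoeff c).2
  have hu : IsUnit ((d : E) * (⟨_, hyE⟩ : E) ^ (d - 1)) := by
    have hne : (d : K) * constantCoeff y ^ (d - 1) ≠ 0 := mul_ne_zero hd (pow_ne_zero _ hy)
    refine IsUnit.of_mul_eq_one ⟨_, hinv _ ((d : E) * (⟨_, hyE⟩ : E) ^ (d - 1)).2⟩ ?_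
    ext
    simpa using mul_inv_cancel₀ hne
  obtain ⟨z, hz, hzN⟩ := exists_X_pow_dvd_pow_add c ⟨_, hyE⟩ (by ext; simpa using h0) hu N
  have hzN' : X ^ N ∣ map E.subtype z ^ d + map E.subtype c := by
    simpa using map_dvd (map E.subtype) hzN
  have hz' : constantCoeff (map E.subtype z) = constantCoeff y := by
    rw [← coeff_zero_eq_constantCoeff_apply, coeff_map, coeff_zero_eq_constantCoeff_apply, hz]
    rfl
  have := X_pow_dvd_sub_of_pow_add h hzN' hz'.symm (by
    rw [hz']; exact (mul_ne_zero hd (pow_ne_zero _ hy)).isUnit)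
  have := X_pow_dvd_iff.1 this j hj
  rw [map_sub, sub_eq_zero, coeff_map] at this
  rw [this]
  exact (coeff j z).2

lemma X_pow_dvd_iff_le_order {R : Type*} [CommRing R] {f : R⟦X⟧} {e : ℕ} :
    X ^ e ∣ f ↔ (e : ℕ∞) ≤ f.order := by
  rw [X_pow_dvd_iff]
  exact ⟨nat_le_order f e, fun h m hm ↦ coeff_of_lt_order m (lt_of_lt_of_le (by exact_mod_cast hm) h)⟩

lemma X_pow_ceilDiv_dvd {R : Type*} [CommRing R] [IsDomain R] {f : R⟦X⟧} {e d : ℕ} (hd : d ≠ 0)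
    (h : X ^ e ∣ f ^ d) : X ^ (e ⌈/⌉ d) ∣ f := by
  rw [X_pow_dvd_iff_le_order] at h ⊢
  rw [order_pow] at h
  cases ho : f.order with
  | top => exact le_top
  | coe n =>
    rw [ho, nsmul_eq_mul] at h
    have h : e ≤ d * n := by exact_mod_cast h
    exact_mod_cast (ceilDiv_le_iff_le_mul (Nat.pos_of_ne_zero hd)).2 h

end PowerSeries

/-- The elements of `K` that are algebraic over the `k`-subalgebra generated by `B`. -/
def relAlgClosure (k : Type*) {K : Type*} [Field k] [Field K] [Algebra k K] (B : Set K) :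
    Subring K :=
  (Subalgebra.algebraicClosure (Algebra.adjoin k B) K).toSubring

namespace relAlgClosure

variable {k K : Type*} [Field k] [Field K] [Algebra k K] {B B' : Set K} {x : K}

lemma mem_iff : x ∈ relAlgClosure k B ↔ IsAlgebraic (Algebra.adjoin k B) x :=
  Subalgebra.mem_algebraicClosure _ _

lemma subset : B ⊆ relAlgClosure k B := fun x hx ↦
  mem_iff.2 (isAlgebraic_algebraMap (⟨x, Algebra.subset_adjoin hx⟩ : Algebra.adjoin k B))

lemma mono (h : B ⊆ B') : relAlgClosure k B ≤ relAlgClosure k B' := fun x hx ↦ by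
  have := AlgebraicIndependent.matroid_closure_eq (R := k) (s := B)
  have h' := AlgebraicIndependent.matroid_closure_eq (R := k) (s := B')
  have hx' : x ∈ (AlgebraicIndependent.matroid k K).closure B := this ▸ hx
  have := (AlgebraicIndependent.matroid k K).closure_subset_closure h hx'
  rw [h'] at this
  exact this

lemma inv_mem (hx : x ∈ relAlgClosure k B) : x⁻¹ ∈ relAlgClosure k B :=
  mem_iff.2 (mem_iff.1 hx).inv

lemma mem_of_pow_mem {d : ℕ} (hd : d ≠ 0) (hx : x ^ d ∈ relAlgClosure k B) :
    x ∈ relAlgClosure k B :=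
  mem_iff.2 (IsAlgebraic.of_pow (Nat.pos_of_ne_zero hd) (mem_iff.1 hx))

end relAlgClosure

/-- If a diagonal form over `ZMod p` is anisotropic, the sum of the inverses of its exponents is
at most one. -/
lemma ZMod.sum_one_div_le_one_of_anisotropic {ι : Type*} [Fintype ι] (p : ℕ) [Fact p.Prime]
    (d : ι → ℕ) (hd : ∀ i, d i ≠ 0) (h : ∀ x : ι → ZMod p, ∑ i, x i ^ d i = 0 → x = 0) :
    ∑ i, (1 / d i : ℚ) ≤ 1 := by
  classical
  have hp : 1 < p := (Fact.out : p.Prime).one_lt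
  cases isEmpty_or_nonempty ι
  · simp
  by_contra! hlt
  have h1 : ∑ x : ι → ZMod p, (∑ i, x i ^ d i) ^ (p - 1) = -1 := by
    have : ∀ x : ι → ZMod p, (∑ i, x i ^ d i) ^ (p - 1) = 1 - if x = 0 then 1 else 0 := fun x ↦ by
      split_ifs with hx
      · subst hx
        simp [hd, Nat.sub_ne_zero_of_lt hp]
      · rw [ZMod.pow_card_sub_one_eq_one fun h0 ↦ hx (h x h0), sub_zero]
    simp [this, Finset.sum_sub_distrib]
  have h2 : ∑ x : ι → ZMod p, (∑ i, x i ^ d i) ^ (p - 1) = 0 := by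
    simp_rw [Finset.sum_pow_eq_sum_piAntidiag]
    rw [Finset.sum_comm]
    refine Finset.sum_eq_zero fun a ha ↦ ?_
    rw [Finset.mem_piAntidiag] at ha
    rw [← Finset.mul_sum]
    have : ∑ x : ι → ZMod p, ∏ i, (x i ^ d i) ^ a i = ∏ i, ∑ t : ZMod p, t ^ (d i * a i) := by
      rw [Finset.prod_univ_sum]
      simp [pow_mul]
    obtain ⟨i, hi⟩ : ∃ i, d i * a i < p - 1 := by
      by_contra! hall
      have h3 : ∀ i, ((p - 1 : ℕ) : ℚ) * (1 / d i) ≤ a i := fun i ↦ by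
        have : (0 : ℚ) < d i := by exact_mod_cast Nat.pos_of_ne_zero (hd i)
        rw [mul_one_div, div_le_iff₀ this, mul_comm]
        exact_mod_cast hall i
      have h4 := Finset.sum_le_sum fun i (_ : i ∈ Finset.univ) ↦ h3 i
      rw [← Finset.mul_sum] at h4
      have h5 : ∑ i, (a i : ℚ) = (p - 1 : ℕ) := by exact_mod_cast ha.1
      rw [h5] at h4
      have h6 : (0 : ℚ) < (p - 1 : ℕ) := by exact_mod_cast Nat.sub_pos_of_lt hp
      nlinarith
    rw [this, Finset.prod_eq_zero (Finset.mem_univ i), mul_zero]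
    exact FiniteField.sum_pow_lt_card_sub_one _ _ (by simpa using hi)
  rw [h1] at h2
  simp at h2

section Jets

open PowerSeries

lemma PowerSeries.mem_range_map_subtype {K : Type*} [CommRing K] {E : Subring K} {f : K⟦X⟧} :
    f ∈ (map E.subtype).range ↔ ∀ j, coeff j f ∈ E := by
  refine ⟨?_, fun h ↦ ⟨PowerSeries.mk fun j ↦ ⟨_, h j⟩, by ext j; simp⟩⟩
  rintro ⟨g, rfl⟩ j
  rw [coeff_map]
  exact (coeff j g).2

lemma PowerSeries.exists_eq_X_pow_mul_of_mem_range {K : Type*} [CommRing K] {E : Subring K}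
    {f : K⟦X⟧} (hf : f ∈ (map E.subtype).range) {e : ℕ} (h : X ^ e ∣ f) :
    ∃ c ∈ (map E.subtype).range, f = X ^ e * c := by
  obtain ⟨c, rfl⟩ := h
  refine ⟨c, mem_range_map_subtype.2 fun j ↦ ?_, rfl⟩
  have := mem_range_map_subtype.1 hf (j + e)
  rwa [coeff_X_pow_mul] at this

lemma PowerSeries.exists_eq_X_pow_mul_of_pow {K : Type*} [Field K] {f : K⟦X⟧} {e d : ℕ}
    (hd : d ≠ 0) (h : X ^ e ∣ f ^ d) (h' : ¬ X ^ (e + 1) ∣ f ^ d) :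
    ∃ w y, e = d * w ∧ f = X ^ w * y ∧ constantCoeff y ≠ 0 := by
  rw [X_pow_dvd_iff_le_order, order_pow] at h h'
  cases ho : f.order with
  | top =>
    simp [ho, hd] at h'
  | coe n =>
    rw [ho, nsmul_eq_mul, not_le] at h'
    rw [ho, nsmul_eq_mul] at h
    have h1 : e ≤ d * n := by exact_mod_cast h
    have h2 : d * n < e + 1 := by exact_mod_cast h'
    have hdvd : X ^ n ∣ f := X_pow_dvd_iff_le_order.2 ho.ge
    obtain ⟨y, hy⟩ := hdvd
    refine ⟨n, y, by omega, hy, fun h0 ↦ ?_⟩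
    obtain ⟨z, rfl⟩ := X_dvd_iff.2 h0
    have : X ^ (n + 1) ∣ f := ⟨z, by rw [hy]; ring⟩
    rw [X_pow_dvd_iff_le_order, ho] at this
    have : n + 1 ≤ n := by exact_mod_cast this
    omega

/-- The coefficients of degree `< M` of the power series `ξ i`, `i ∈ S`, are algebraic over the
field generated by `B`. -/
def CoeffsAlgebraicOver (k : Type*) {K ι : Type*} [Field k] [Field K] [Algebra k K] (M : ℕ)
    (ξ : ι → K⟦X⟧) (S : Finset ι) (B : Set K) : Prop :=
  ∀ i ∈ S, ∀ j < M, coeff j (ξ i) ∈ relAlgClosure k B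

lemma CoeffsAlgebraicOver.mono {k K ι : Type*} [Field k] [Field K] [Algebra k K] {M : ℕ}
    {ξ : ι → K⟦X⟧} {S : Finset ι} {B B' : Set K} (h : CoeffsAlgebraicOver k M ξ S B)
    (hB : B ⊆ B') : CoeffsAlgebraicOver k M ξ S B' :=
  fun i hi j hj ↦ relAlgClosure.mono hB (h i hi j hj)

lemma sum_pow_mem_range_map_subtype {K ι : Type*} [CommRing K] {E : Subring K} {M : ℕ}
    {ξ : ι → K⟦X⟧} (hξ : ∀ i j, M ≤ j → coeff j (ξ i) = 0) (d : ι → ℕ) {S : Finset ι}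
    (h : ∀ i ∈ S, ∀ j < M, coeff j (ξ i) ∈ E) :
    ∑ i ∈ S, ξ i ^ d i ∈ (map E.subtype).range := by
  refine sum_mem fun i hi ↦ pow_mem (mem_range_map_subtype.2 fun j ↦ ?_) _
  rcases lt_or_ge j M with hj | hj
  · exact h i hi j hj
  · rw [hξ i j hj]; exact zero_mem E

/-- The coefficients of `f` of degrees in `[w, M)`. -/
def coeffFinset {K : Type*} [Field K] [DecidableEq K] (f : K⟦X⟧) (w M : ℕ) : Finset K :=
  (Finset.Ico w M).image fun j ↦ coeff j f

lemma card_coeffFinset_le {K : Type*} [Field K] [DecidableEq K] (f : K⟦X⟧) {w M : ℕ}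
    (h : w ≤ M) : ((coeffFinset f w M).card : ℚ) ≤ M - w := by
  have : (coeffFinset f w M).card ≤ M - w := Finset.card_image_le.trans (by simp)
  rw [← Nat.cast_sub h]
  exact_mod_cast this

lemma card_coeffFinset_ceilDiv_le {K : Type*} [Field K] [DecidableEq K] (f : K⟦X⟧) {e d M : ℕ}
    (hd : d ≠ 0) (h : e ≤ M) :
    ((coeffFinset f (e ⌈/⌉ d) M).card : ℚ) ≤ M - e * (1 / d : ℚ) := by
  have hd' : 0 < d := Nat.pos_of_ne_zero hd
  have h1 : e ⌈/⌉ d ≤ M :=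
    (ceilDiv_le_iff_le_mul hd').2 (h.trans (Nat.le_mul_of_pos_left _ hd'))
  refine (card_coeffFinset_le f h1).trans ?_
  have h2 : e ≤ d * (e ⌈/⌉ d) := (ceilDiv_le_iff_le_mul hd').1 le_rfl
  have h3 : (e : ℚ) ≤ d * (e ⌈/⌉ d : ℕ) := by exact_mod_cast h2
  have : (e : ℚ) * (1 / d) ≤ (e ⌈/⌉ d : ℕ) := by
    rw [mul_one_div, div_le_iff₀ (by positivity)]
    linarith
  linarith

lemma exists_coeffsAlgebraicOver_of_dvd_pow {k K ι : Type*} [Field k] [Field K] [Algebra k K]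
    {M e : ℕ} (he : e ≤ M) (ξ : ι → K⟦X⟧) (d : ι → ℕ) (T : Finset ι) (hd : ∀ i ∈ T, d i ≠ 0)
    (h : ∀ i ∈ T, X ^ e ∣ ξ i ^ d i) :
    ∃ B : Finset K, CoeffsAlgebraicOver k M ξ T B ∧
      (B.card : ℚ) ≤ T.card * M - e * ∑ i ∈ T, (1 / d i : ℚ) := by
  classical
  refine ⟨T.biUnion fun i ↦ coeffFinset (ξ i) (e ⌈/⌉ d i) M, fun i hi j hj ↦ ?_, ?_⟩
  · rcases lt_or_ge j (e ⌈/⌉ d i) with hj' | hj'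
    · rw [X_pow_dvd_iff.1 (X_pow_ceilDiv_dvd (hd i hi) (h i hi)) j hj']
      exact zero_mem _
    · refine relAlgClosure.subset ?_
      simp only [coeffFinset, Finset.coe_biUnion, Set.mem_iUnion, Finset.mem_coe]
      exact ⟨i, hi, Finset.mem_image_of_mem _ (Finset.mem_Ico.2 ⟨hj', hj⟩)⟩
  · calc _ ≤ ∑ i ∈ T, ((coeffFinset (ξ i) (e ⌈/⌉ d i) M).card : ℚ) := by
          exact_mod_cast Finset.card_biUnion_le
      _ ≤ ∑ i ∈ T, ((M : ℚ) - e * (1 / d i)) :=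
          Finset.sum_le_sum fun i hi ↦ card_coeffFinset_ceilDiv_le _ (hd i hi) he
      _ = _ := by rw [Finset.sum_sub_distrib, Finset.mul_sum]; simp

/-- If one summand `ξ i ^ d i` of a sum divisible by `X ^ a` has order exactly `e < a`, then the
vanishing of the sum modulo `X ^ a` determines `a - e` coefficients of `ξ i` up to finitely many
choices. -/
lemma exists_coeffsAlgebraicOver_insert {k K : Type*} [Field k] [Field K] [Algebra k K]
    {M a e d : ℕ} (ha : a ≤ M) (hea : e < a) (hd : (d : K) ≠ 0) (f G : K⟦X⟧) (B : Finset K)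
    (hG : G ∈ (map (relAlgClosure k (B : Set K)).subtype).range) (hGe : X ^ e ∣ G)
    (he : X ^ e ∣ f ^ d) (he' : ¬ X ^ (e + 1) ∣ f ^ d) (h : X ^ a ∣ f ^ d + G) :
    ∃ B' : Finset K, B ⊆ B' ∧ (∀ j < M, coeff j f ∈ relAlgClosure k (B' : Set K)) ∧
      (B'.card : ℚ) ≤ B.card + (M - e * (1 / d : ℚ)) - (a - e) := by
  classical
  have hd0 : d ≠ 0 := by rintro rfl; simp at hd
  obtain ⟨w, y, rfl, rfl, hy⟩ := exists_eq_X_pow_mul_of_pow hd0 he he'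
  obtain ⟨c, hc, rfl⟩ := exists_eq_X_pow_mul_of_mem_range hG hGe
  have hdvd : X ^ (a - d * w) ∣ y ^ d + c := by
    have : X ^ (d * w) * X ^ (a - d * w) ∣ X ^ (d * w) * (y ^ d + c) := by
      rw [← pow_add, Nat.add_sub_cancel' hea.le]
      convert h using 1
      ring
    exact (mul_dvd_mul_iff_left (pow_ne_zero _ X_ne_zero)).1 this
  have hw : w ≤ d * w := Nat.le_mul_of_pos_left _ (Nat.pos_of_ne_zero hd0)
  refine ⟨B ∪ coeffFinset (X ^ w * y) (w + (a - d * w)) M, Finset.subset_union_left,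
    fun j hj ↦ ?_, ?_⟩
  · rcases lt_or_ge j w with hjw | hjw
    · rw [X_pow_dvd_iff.1 (dvd_mul_right _ y) j hjw]
      exact zero_mem _
    · rcases lt_or_ge j (w + (a - d * w)) with hj' | hj'
      · refine relAlgClosure.mono (B := B) (by simp) ?_
        obtain ⟨j, rfl⟩ := Nat.exists_eq_add_of_le hjw
        rw [add_comm w j, coeff_X_pow_mul]
        exact coeff_mem_of_X_pow_dvd_pow_add _ (fun _ ↦ relAlgClosure.inv_mem)
          (fun _ _ ↦ relAlgClosure.mem_of_pow_mem) hd hy hc hdvd (by omega)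
      · refine relAlgClosure.subset ?_
        simp only [coeffFinset, Finset.coe_union]
        exact Or.inr (Finset.mem_image_of_mem _ (Finset.mem_Ico.2 ⟨hj', hj⟩))
  · have h1 : ((B ∪ coeffFinset (X ^ w * y) (w + (a - d * w)) M).card : ℚ) ≤
        B.card + (coeffFinset (X ^ w * y) (w + (a - d * w)) M).card := by
      exact_mod_cast Finset.card_union_le _ _
    have h2 := card_coeffFinset_le (X ^ w * y) (w := w + (a - d * w)) (M := M) (by omega)
    have h3 : ((w + (a - d * w) : ℕ) : ℚ) = w + (a - d * w) := by
      push_cast [Nat.cast_sub hea.le]; ring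
    have h4 : ((d * w : ℕ) : ℚ) * (1 / d) = w := by
      have : (d : ℚ) ≠ 0 := by exact_mod_cast hd0
      push_cast; field_simp
    rw [h3] at h2
    rw [h4]
    push_cast
    linarith

lemma exists_coeffsAlgebraicOver_of_dvd_sum {k K ι : Type*} [Field k] [Field K] [Algebra k K]
    {M a : ℕ} (ha : a ≤ M) (ξ : ι → K⟦X⟧) (hξ : ∀ i j, M ≤ j → coeff j (ξ i) = 0) (d : ι → ℕ)
    (S T : Finset ι) (hdT : ∀ i ∈ T, (d i : K) ≠ 0) (μ : ℚ)
    (hS : ∀ e ≤ a, X ^ e ∣ ∑ i ∈ S, ξ i ^ d i → ∃ B : Finset K, CoeffsAlgebraicOver k M ξ S B ∧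
      (B.card : ℚ) ≤ S.card * M - e * μ)
    (h : X ^ a ∣ ∑ i ∈ S, ξ i ^ d i + ∑ i ∈ T, ξ i ^ d i) :
    ∃ e ≤ a, (1 ≤ a → (∀ i ∈ T, X ∣ ξ i) → 1 ≤ e) ∧ ∃ B : Finset K,
      CoeffsAlgebraicOver k M ξ S B ∧ CoeffsAlgebraicOver k M ξ T B ∧
      (B.card : ℚ) ≤ (S.card + T.card) * M - e * (μ + ∑ i ∈ T, (1 / d i : ℚ)) - (a - e) := by
  classical
  have hd0 : ∀ i ∈ T, d i ≠ 0 := fun i hi h0 ↦ hdT i hi (by simp [h0])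
  let Q : ℕ → Prop := fun e ↦ X ^ e ∣ ∑ i ∈ S, ξ i ^ d i ∧ ∀ i ∈ T, X ^ e ∣ ξ i ^ d i
  obtain ⟨e, hea, hQe, hmax⟩ : ∃ e ≤ a, Q e ∧ ∀ e', e < e' → e' ≤ a → ¬ Q e' :=
    ⟨Nat.findGreatest Q a, Nat.findGreatest_le a,
      Nat.findGreatest_spec (m := 0) (Nat.zero_le _) ⟨by simp, by simp⟩,
      fun e' h h' ↦ Nat.findGreatest_is_greatest h h'⟩
  refine ⟨e, hea, fun ha1 hT ↦ ?_, ?_⟩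
  · by_contra! he
    have hT1 : ∀ i ∈ T, X ^ 1 ∣ ξ i ^ d i := fun i hi ↦ by
      rw [pow_one]; exact dvd_pow (hT i hi) (hd0 i hi)
    exact hmax 1 he ha1
      ⟨(dvd_add_left (Finset.dvd_sum hT1)).1 ((pow_dvd_pow _ ha1).trans h), hT1⟩
  obtain ⟨B₀, hB₀, hB₀c⟩ := hS e hea hQe.1
  rcases hea.eq_or_lt with rfl | hlt
  · obtain ⟨B₁, hB₁, hB₁c⟩ := exists_coeffsAlgebraicOver_of_dvd_pow (k := k) ha ξ d T hd0 hQe.2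
    refine ⟨B₀ ∪ B₁, hB₀.mono (by simp), hB₁.mono (by simp), ?_⟩
    have : ((B₀ ∪ B₁).card : ℚ) ≤ B₀.card + B₁.card := by exact_mod_cast Finset.card_union_le _ _
    linarith
  obtain ⟨i, hi, hie⟩ : ∃ i ∈ T, ¬ X ^ (e + 1) ∣ ξ i ^ d i := by
    by_contra! hall
    exact hmax (e + 1) e.lt_succ_self hlt
      ⟨(dvd_add_left (Finset.dvd_sum hall)).1 ((pow_dvd_pow _ hlt).trans h), hall⟩
  obtain ⟨B₁, hB₁, hB₁c⟩ := exists_coeffsAlgebraicOver_of_dvd_pow (k := k) (hea.trans ha) ξ d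
    (T.erase i) (fun j hj ↦ hd0 j (Finset.mem_of_mem_erase hj))
    (fun j hj ↦ hQe.2 j (Finset.mem_of_mem_erase hj))
  have hsum := Finset.add_sum_erase T (fun j ↦ ξ j ^ d j) hi
  obtain ⟨B₂, hB₂, hB₂i, hB₂c⟩ := exists_coeffsAlgebraicOver_insert (k := k) ha hlt (hdT i hi) (ξ i)
    (∑ j ∈ S, ξ j ^ d j + ∑ j ∈ T.erase i, ξ j ^ d j) (B₀ ∪ B₁)
    (add_mem (sum_pow_mem_range_map_subtype hξ d (hB₀.mono (by simp)))
      (sum_pow_mem_range_map_subtype hξ d (hB₁.mono (by simp))))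
    (dvd_add hQe.1 (Finset.dvd_sum fun j hj ↦ hQe.2 j (Finset.mem_of_mem_erase hj)))
    (hQe.2 i hi) hie (by convert h using 1; rw [← hsum]; ring)
  refine ⟨B₂, hB₀.mono fun x hx ↦ hB₂ (Finset.mem_union_left _ hx), fun j hj ↦ ?_, ?_⟩
  · rcases eq_or_ne j i with rfl | hji
    · exact hB₂i
    · exact hB₁.mono (fun x hx ↦ hB₂ (Finset.mem_union_right _ hx)) j
        (Finset.mem_erase.2 ⟨hji, hj⟩)
  · have h1 : ((B₀ ∪ B₁).card : ℚ) ≤ B₀.card + B₁.card := by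
      exact_mod_cast Finset.card_union_le _ _
    have h2 := Finset.add_sum_erase T (fun j ↦ (1 / d j : ℚ)) hi
    have h3 : ((T.erase i).card : ℚ) = T.card - 1 := by
      rw [Finset.card_erase_of_mem hi, Nat.cast_sub (Finset.card_pos.2 ⟨i, hi⟩)]; simp
    rw [← h2]
    rw [h3] at hB₁c
    linarith

/-- The diagonal form with exponents `d i`, `i ∈ S`, has no nontrivial zero over `ZMod p`. -/
def IsAnisotropicOn {ι : Type*} (p : ℕ) (S : Finset ι) (d : ι → ℕ) : Prop :=
  ∀ x : ι → ZMod p, ∑ i ∈ S, x i ^ d i = 0 → ∀ i ∈ S, x i = 0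

namespace IsAnisotropicOn

variable {ι : Type*} {p : ℕ} {S S' : Finset ι} {d : ι → ℕ}

lemma subset (h : IsAnisotropicOn p S d) (hd : ∀ i ∈ S, d i ≠ 0) (hS : S' ⊆ S) :
    IsAnisotropicOn p S' d := by
  classical
  intro x hx i hi
  have := h (fun i ↦ if i ∈ S' then x i else 0) (by
    refine Eq.trans ?_ hx
    rw [← Finset.sum_subset hS]
    · exact Finset.sum_congr rfl fun j hj ↦ by rw [if_pos hj]
    · exact fun j hj hj' ↦ by rw [if_neg hj', zero_pow (hd j hj)]) i (hS hi)
  rwa [if_pos hi] at this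

lemma div [Fact p.Prime] (h : IsAnisotropicOn p S d) (hd : ∀ i ∈ S, p ∣ d i) :
    IsAnisotropicOn p S (fun i ↦ d i / p) := by
  refine fun x hx ↦ h x ?_
  rw [← hx]
  refine Finset.sum_congr rfl fun i hi ↦ ?_
  rw [← ZMod.pow_card (x i ^ (d i / p)), ← pow_mul, Nat.div_mul_cancel (hd i hi)]

lemma sum_one_div_le_one [Fact p.Prime] (h : IsAnisotropicOn p S d) (hd : ∀ i ∈ S, d i ≠ 0) :
    ∑ i ∈ S, (1 / d i : ℚ) ≤ 1 := by
  classical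
  rw [← Finset.sum_coe_sort]
  refine ZMod.sum_one_div_le_one_of_anisotropic p (fun i : S ↦ d i) (fun i ↦ hd i i.2) fun x hx ↦ ?_
  have := h (fun i ↦ if hi : i ∈ S then x ⟨i, hi⟩ else 0) (by
    rw [← Finset.sum_coe_sort, ← hx]
    exact Finset.sum_congr rfl fun i _ ↦ by simp)
  ext i
  simpa using congrArg ZMod.val (this i i.2)

end IsAnisotropicOn

lemma exists_coeffsAlgebraicOver_of_frobenius {k K ι : Type*} [Field k] [Field K] [Algebra k K]
    (p : ℕ) [Fact p.Prime] [CharP K p] {M e : ℕ} (he : e ≤ M) {ξ : ι → K⟦X⟧} {d : ι → ℕ}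
    {S : Finset ι} (hd : ∀ i ∈ S, p ∣ d i)
    (ih : ∀ e' ≤ M, X ^ e' ∣ ∑ i ∈ S, ξ i ^ (d i / p) → ∃ B : Finset K,
      CoeffsAlgebraicOver k M ξ S B ∧
        (B.card : ℚ) ≤ S.card * M - e' * ∑ i ∈ S, (1 / (d i / p : ℕ) : ℚ))
    (h : X ^ e ∣ ∑ i ∈ S, ξ i ^ d i) :
    ∃ B : Finset K, CoeffsAlgebraicOver k M ξ S B ∧
      (B.card : ℚ) ≤ S.card * M - e * ∑ i ∈ S, (1 / d i : ℚ) := by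
  have hp : 0 < p := (Fact.out : p.Prime).pos
  have : CharP K⟦X⟧ p := charP_of_injective_ringHom (C_injective (R := K)) p
  have hsum : (∑ i ∈ S, ξ i ^ (d i / p)) ^ p = ∑ i ∈ S, ξ i ^ d i := by
    rw [sum_pow_char]
    exact Finset.sum_congr rfl fun i hi ↦ by rw [← pow_mul, Nat.div_mul_cancel (hd i hi)]
  rw [← hsum] at h
  obtain ⟨B, hB, hBc⟩ := ih (e ⌈/⌉ p)
    ((ceilDiv_le_iff_le_mul hp).2 (he.trans (Nat.le_mul_of_pos_left _ hp)))
    (X_pow_ceilDiv_dvd hp.ne' h)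
  refine ⟨B, hB, hBc.trans (sub_le_sub_left ?_ _)⟩
  have h1 : ∑ i ∈ S, (1 / (d i / p : ℕ) : ℚ) = p * ∑ i ∈ S, (1 / d i : ℚ) := by
    rw [Finset.mul_sum]
    refine Finset.sum_congr rfl fun i hi ↦ ?_
    rw [Nat.cast_div (hd i hi) (by exact_mod_cast hp.ne'), one_div_div, mul_one_div]
  have h2 : (e : ℚ) ≤ p * (e ⌈/⌉ p : ℕ) := by exact_mod_cast (ceilDiv_le_iff_le_mul hp).1 le_rfl
  have h3 : (0 : ℚ) ≤ ∑ i ∈ S, (1 / d i : ℚ) := Finset.sum_nonneg fun i _ ↦ by positivity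
  rw [h1]
  nlinarith

lemma exists_coeffsAlgebraicOver_of_isAnisotropicOn {k K ι : Type*} [Field k] [Field K]
    [Algebra k K] (p : ℕ) [Fact p.Prime] [CharP K p] {M : ℕ} (ξ : ι → K⟦X⟧)
    (hξ : ∀ i j, M ≤ j → coeff j (ξ i) = 0) (d : ι → ℕ) (S : Finset ι) (hd : ∀ i ∈ S, d i ≠ 0)
    (hS : IsAnisotropicOn p S d) {a : ℕ} (ha : a ≤ M) (h : X ^ a ∣ ∑ i ∈ S, ξ i ^ d i) :
    ∃ B : Finset K, CoeffsAlgebraicOver k M ξ S B ∧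
      (B.card : ℚ) ≤ S.card * M - a * ∑ i ∈ S, (1 / d i : ℚ) := by
  classical
  induction hN : ∑ i ∈ S, d i using Nat.strong_induction_on generalizing d S a with
  | _ N ih =>
  subst hN
  have hp : p.Prime := Fact.out
  rw [← Finset.sum_filter_add_sum_filter_not S (fun i ↦ p ∣ d i)] at h
  obtain ⟨e, hea, -, B, hB₁, hB₂, hBc⟩ := exists_coeffsAlgebraicOver_of_dvd_sum (k := k) ha ξ hξ d
    (S.filter fun i ↦ p ∣ d i) (S.filter fun i ↦ ¬ p ∣ d i)
    (fun i hi ↦ by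
      rw [Ne, CharP.cast_eq_zero_iff K p]
      exact (Finset.mem_filter.1 hi).2)
    (∑ i ∈ S.filter fun i ↦ p ∣ d i, (1 / d i : ℚ))
    (fun e he hdvd ↦ by
      have hdS : ∀ i ∈ S.filter fun i ↦ p ∣ d i, p ∣ d i := fun i hi ↦ (Finset.mem_filter.1 hi).2
      have hd' : ∀ i ∈ S.filter fun i ↦ p ∣ d i, d i ≠ 0 :=
        fun i hi ↦ hd i (Finset.mem_filter.1 hi).1
      rcases (S.filter fun i ↦ p ∣ d i).eq_empty_or_nonempty with h0 | h0
      · rw [h0]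
        exact ⟨∅, by simp [CoeffsAlgebraicOver], by simp⟩
      refine exists_coeffsAlgebraicOver_of_frobenius p (he.trans ha) hdS (fun e' he' hdvd' ↦ ?_) hdvd
      refine ih _ ?_ _ _ (fun i hi ↦ ?_)
        ((hS.subset hd (Finset.filter_subset _ _)).div hdS) he' hdvd' rfl
      · refine (Finset.sum_lt_sum_of_nonempty h0 fun i hi ↦
          Nat.div_lt_self (Nat.pos_of_ne_zero (hd' i hi)) hp.one_lt).trans_le ?_
        exact Finset.sum_le_sum_of_subset (Finset.filter_subset _ _)
      · exact (Nat.div_pos (Nat.le_of_dvd (Nat.pos_of_ne_zero (hd' i hi)) (hdS i hi)) hp.pos).ne')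
    h
  refine ⟨B, fun i hi ↦ ?_, ?_⟩
  · by_cases hpi : p ∣ d i
    · exact hB₁ i (Finset.mem_filter.2 ⟨hi, hpi⟩)
    · exact hB₂ i (Finset.mem_filter.2 ⟨hi, hpi⟩)
  · rw [Finset.sum_filter_add_sum_filter_not] at hBc
    have h1 : ((S.filter fun i ↦ p ∣ d i).card : ℚ) + (S.filter fun i ↦ ¬ p ∣ d i).card =
        S.card := by exact_mod_cast Finset.card_filter_add_card_filter_not (fun i ↦ p ∣ d i)
    have h2 := hS.sum_one_div_le_one hd
    have h3 : (e : ℚ) ≤ a := by exact_mod_cast hea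
    rw [h1] at hBc
    nlinarith

lemma isAnisotropicOn_of_smooth {k ι : Type*} [Field k] [Fintype ι] [DecidableEq ι] {d : ι → ℕ}
    (hd : ∀ i, 2 ≤ d i)
    (hsm : ∀ x : ι → k, MvPolynomial.eval x (∑ i, MvPolynomial.X i ^ d i) = 0 → x ≠ 0 →
      ∃ i, MvPolynomial.eval x (MvPolynomial.pderiv i (∑ i, MvPolynomial.X i ^ d i)) ≠ 0)
    (p : ℕ) [Fact p.Prime] [CharP k p] :
    IsAnisotropicOn p (Finset.univ.filter fun i ↦ p ∣ d i) d := by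
  intro x hx i hi
  by_contra hne
  let φ : ZMod p →+* k := ZMod.castHom dvd_rfl k
  let y : ι → k := fun i ↦ if p ∣ d i then φ (x i) else 0
  have hy : MvPolynomial.eval y (∑ i, MvPolynomial.X i ^ d i) = 0 := by
    have : ∀ i, y i ^ d i = if p ∣ d i then φ (x i ^ d i) else 0 := fun i ↦ by
      have : d i ≠ 0 := by have := hd i; omega
      simp only [y]; split_ifs <;> simp [this]
    simp only [map_sum, map_pow, MvPolynomial.eval_X, this, ← Finset.sum_filter]
    simp only [← map_pow, ← map_sum]
    rw [hx, map_zero]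
  have hy0 : y ≠ 0 := fun h0 ↦ hne <| by
    have := congrFun h0 i
    simp only [y, if_pos (Finset.mem_filter.1 hi).2, Pi.zero_apply] at this
    exact (map_eq_zero φ).1 this
  obtain ⟨j, hj⟩ := hsm y hy hy0
  apply hj
  rw [map_sum, map_sum]
  refine Finset.sum_eq_zero fun l _ ↦ ?_
  rw [MvPolynomial.pderiv_pow]
  rcases eq_or_ne l j with rfl | hlj
  · by_cases hpl : p ∣ d l
    · simp [(CharP.cast_eq_zero_iff k p _).2 hpl]
    · have : d l - 1 ≠ 0 := by have := hd l; omega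
      simp [y, hpl, this]
  · simp [MvPolynomial.pderiv_X_of_ne hlj]

lemma exists_card_add_lt_of_dvd_sum {k K ι : Type*} [Field k] [Field K] [Algebra k K] [Fintype ι]
    [DecidableEq ι] {d : ι → ℕ} (hd : ∀ i, d i ≠ 0)
    (han : ∀ p : ℕ, p.Prime → CharP k p →
      IsAnisotropicOn p (Finset.univ.filter fun i ↦ p ∣ d i) d)
    (hsum : 1 < ∑ i, (1 / d i : ℚ)) {M : ℕ} (hM : 1 ≤ M) (ξ : ι → K⟦X⟧)
    (hξ : ∀ i j, M ≤ j → coeff j (ξ i) = 0) (h : X ^ M ∣ ∑ i, ξ i ^ d i)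
    (h0 : ∀ i, (d i : K) ≠ 0 → X ∣ ξ i) :
    ∃ B : Finset K, (∀ i, ∀ j < M, coeff j (ξ i) ∈ relAlgClosure k (B : Set K)) ∧
      B.card + M < Fintype.card ι * M := by
  classical
  let S : Finset ι := Finset.univ.filter fun i ↦ (d i : K) = 0
  have hS : ∀ e ≤ M, X ^ e ∣ ∑ i ∈ S, ξ i ^ d i → ∃ B : Finset K, CoeffsAlgebraicOver k M ξ S B ∧
      (B.card : ℚ) ≤ S.card * M - e * ∑ i ∈ S, (1 / d i : ℚ) := by
    intro e he hdvd
    obtain ⟨p, hp⟩ := CharP.exists K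
    rcases CharP.char_is_prime_or_zero K p with hpp | rfl
    · have : Fact p.Prime := ⟨hpp⟩
      have hk : CharP k p := (algebraMap k K).charP (algebraMap k K).injective p
      have hSp : S = Finset.univ.filter fun i ↦ p ∣ d i := by
        ext i; simp [S, CharP.cast_eq_zero_iff K p]
      have hpS : ∀ i ∈ S, p ∣ d i := fun i hi ↦ by simpa [hSp] using hi
      refine exists_coeffsAlgebraicOver_of_frobenius p he hpS (fun e' he' hdvd' ↦ ?_) hdvd
      refine exists_coeffsAlgebraicOver_of_isAnisotropicOn p ξ hξ _ S (fun i hi ↦ ?_) ?_ he' hdvd'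
      · exact (Nat.div_pos (Nat.le_of_dvd (Nat.pos_of_ne_zero (hd i)) (hpS i hi)) hpp.pos).ne'
      · rw [hSp] at hpS ⊢
        exact (han p hpp hk).div hpS
    · have : CharZero K := CharP.charP_to_charZero K
      have hS0 : S = ∅ := by simp [S, hd]
      rw [hS0]
      exact ⟨∅, by simp [CoeffsAlgebraicOver], by simp⟩
  rw [← Finset.sum_filter_add_sum_filter_not _ (fun i ↦ (d i : K) = 0)] at h
  obtain ⟨e, heM, he, B, hB₁, hB₂, hBc⟩ := exists_coeffsAlgebraicOver_of_dvd_sum (k := k) le_rfl ξ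
    hξ d S (Finset.univ.filter fun i ↦ ¬ (d i : K) = 0) (fun i hi ↦ (Finset.mem_filter.1 hi).2)
    _ hS h
  refine ⟨B, fun i ↦ ?_, ?_⟩
  · by_cases hi : (d i : K) = 0
    · exact hB₁ i (Finset.mem_filter.2 ⟨Finset.mem_univ i, hi⟩)
    · exact hB₂ i (Finset.mem_filter.2 ⟨Finset.mem_univ i, hi⟩)
  · have he1 : (1 : ℚ) ≤ e := by
      exact_mod_cast he hM fun i hi ↦ h0 i (Finset.mem_filter.1 hi).2
    have h1 : (S.card : ℚ) + (Finset.univ.filter fun i ↦ ¬ (d i : K) = 0).card =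
        Fintype.card ι := by
      exact_mod_cast Finset.card_filter_add_card_filter_not (fun i ↦ (d i : K) = 0)
    rw [Finset.sum_filter_add_sum_filter_not, h1] at hBc
    have : (B.card : ℚ) + M < Fintype.card ι * M := by nlinarith
    exact_mod_cast this

lemma one_lt_sum_one_div {ι : Type*} [Fintype ι] {d : ι → ℕ} (hd : ∀ i, d i ≠ 0)
    (h : ∏ i, d i < ∑ i, (∏ i, d i) / d i) : 1 < ∑ i, (1 / d i : ℚ) := by
  have hD : (0 : ℚ) < (∏ i, d i : ℕ) := by
    exact_mod_cast Finset.prod_pos fun i _ ↦ Nat.pos_of_ne_zero (hd i)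
  have h1 : ((∏ i, d i : ℕ) : ℚ) * ∑ i, (1 / d i : ℚ) = (∑ i, (∏ i, d i) / d i : ℕ) := by
    rw [Finset.mul_sum, Nat.cast_sum]
    refine Finset.sum_congr rfl fun i hi ↦ ?_
    rw [Nat.cast_div (Finset.dvd_prod_of_mem d hi) (by exact_mod_cast hd i), mul_one_div]
  have h2 : ((∏ i, d i : ℕ) : ℚ) < (∑ i, (∏ i, d i) / d i : ℕ) := by exact_mod_cast h
  rw [← h1] at h2
  exact (lt_mul_iff_one_lt_right hD).1 h2

/-- The truncated power series with coefficients `x (i, j)`. -/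
def jetSeries {A ι : Type*} [CommRing A] {m : ℕ} (x : ι × Fin (m + 1) → A) (i : ι) :
    A⟦X⟧ :=
  (∑ j : Fin (m + 1), Polynomial.C (x (i, j)) * Polynomial.X ^ (j : ℕ) : Polynomial A)

lemma coeff_jetSeries {A ι : Type*} [CommRing A] {m : ℕ} (x : ι × Fin (m + 1) → A) (i : ι)
    (j : Fin (m + 1)) : coeff (j : ℕ) (jetSeries x i) = x (i, j) := by
  simp [jetSeries, Polynomial.coeff_X_pow, Fin.val_inj, Finset.sum_ite_eq]

lemma coeff_jetSeries_of_le {A ι : Type*} [CommRing A] {m : ℕ} (x : ι × Fin (m + 1) → A) (i : ι)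
    {j : ℕ} (hj : m + 1 ≤ j) : coeff j (jetSeries x i) = 0 := by
  simp only [jetSeries, Polynomial.coeff_coe, Polynomial.finsetSum_coeff,
    Polynomial.coeff_C_mul, Polynomial.coeff_X_pow]
  exact Finset.sum_eq_zero fun l _ ↦ by rw [if_neg (by omega), mul_zero]

lemma constantCoeff_jetSeries {A ι : Type*} [CommRing A] {m : ℕ} (x : ι × Fin (m + 1) → A)
    (i : ι) : constantCoeff (jetSeries x i) = x (i, 0) := by
  simpa using coeff_jetSeries x i 0

lemma jetIdeal_le_ker_aeval_iff {k A ι : Type*} [Field k] [CommRing A] [Algebra k A] [Fintype ι]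
    {m : ℕ} (d : ι → ℕ) (x : ι × Fin (m + 1) → A) :
    jetIdeal k ι m {∑ i, MvPolynomial.X i ^ d i} ≤ RingHom.ker (MvPolynomial.aeval (R := k) x) ↔
      X ^ (m + 1) ∣ ∑ i, jetSeries x i ^ d i := by
  have key : ((jetSub k ι m (∑ i, MvPolynomial.X i ^ d i)).map
      (MvPolynomial.aeval (R := k) x : _ →+* A) : A⟦X⟧) = ∑ i, jetSeries x i ^ d i := by
    rw [← Polynomial.coeToPowerSeries.ringHom_apply, ← Polynomial.coe_mapRingHom]
    simp [jetSub, jetSeries, Polynomial.map_sum]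
  rw [jetIdeal, Ideal.span_le, X_pow_dvd_iff]
  simp only [← key, Polynomial.coeff_coe, Polynomial.coeff_map]
  constructor
  · intro h l hl
    exact h ⟨_, rfl, l, by omega, rfl⟩
  · rintro h _ ⟨_, rfl, l, hl, rfl⟩
    exact h l (by omega)

lemma MvPolynomial.exists_ker_aeval_eq.{u, v} {k : Type u} {σ : Type v} [Field k] (P : Ideal (MvPolynomial σ k))
    [P.IsPrime] : ∃ (K : Type max v u) (_ : Field K) (_ : Algebra k K) (x : σ → K),
      RingHom.ker (aeval (R := k) x) = P := by
  let ψ : MvPolynomial σ k →ₐ[k] FractionRing (MvPolynomial σ k ⧸ P) :=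
    (IsScalarTower.toAlgHom k (MvPolynomial σ k ⧸ P) _).comp (Ideal.Quotient.mkₐ k P)
  refine ⟨FractionRing (MvPolynomial σ k ⧸ P), inferInstance, inferInstance, ψ ∘ X, ?_⟩
  rw [← MvPolynomial.aeval_unique ψ]
  ext f
  simp [ψ, RingHom.mem_ker, Ideal.Quotient.eq_zero_iff_mem]

lemma exists_card_le_height_add {k ι : Type*} [Field k] [Fintype ι] [DecidableEq ι] {d : ι → ℕ}
    (hd : ∀ i, d i ≠ 0)
    (han : ∀ p : ℕ, p.Prime → CharP k p →
      IsAnisotropicOn p (Finset.univ.filter fun i ↦ p ∣ d i) d)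
    (hsum : 1 < ∑ i, (1 / d i : ℚ)) {m : ℕ} (P : Ideal (MvPolynomial (ι × Fin (m + 1)) k))
    [P.IsPrime] (hP : jetIdeal k ι m {∑ i, MvPolynomial.X i ^ d i} ≤ P)
    (h0 : ∀ i, (d i : k) ≠ 0 → MvPolynomial.X (i, 0) ∈ P) :
    ∃ c : ℕ, ((Fintype.card ι * (m + 1) : ℕ) : ℕ∞) ≤ P.height + c ∧
      c + (m + 1) < Fintype.card ι * (m + 1) := by
  obtain ⟨K, _, _, x, rfl⟩ := MvPolynomial.exists_ker_aeval_eq P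
  obtain ⟨B, hB, hBc⟩ := exists_card_add_lt_of_dvd_sum (k := k) hd han hsum (Nat.le_add_left 1 m)
    (jetSeries x) (fun i j hj ↦ coeff_jetSeries_of_le x i hj)
    ((jetIdeal_le_ker_aeval_iff d x).1 hP) (fun i hi ↦ by
      rw [X_dvd_iff, constantCoeff_jetSeries]
      have := h0 i fun h ↦ hi (by rw [← map_natCast (algebraMap k K), h, map_zero])
      simpa [RingHom.mem_ker] using this)
  refine ⟨B.card, ?_, hBc⟩
  have := MvPolynomial.card_le_height_ker_add_card (k := k) x B fun i ↦ by
    rw [← relAlgClosure.mem_iff, ← coeff_jetSeries x i.1 i.2]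
    exact hB _ _ i.2.2
  simpa using this

lemma ringKrullDim_quotient_lt {R : Type*} [CommRing R] {N n : ℕ} (hR : ringKrullDim R ≤ N)
    (J : Ideal R) (h : ∀ P : Ideal R, P.IsPrime → J ≤ P →
      ∃ c : ℕ, (N : ℕ∞) ≤ P.height + c ∧ c < n) :
    ringKrullDim (R ⧸ J) < n := by
  rcases n.eq_zero_or_pos with rfl | hn
  · have : Subsingleton (R ⧸ J) := by
      rw [Ideal.Quotient.subsingleton_iff]
      by_contra hJ
      obtain ⟨P, hP, hJP⟩ := Ideal.exists_le_maximal J hJ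
      obtain ⟨c, -, hc⟩ := h P hP.isPrime hJP
      exact hc.not_ge (Nat.zero_le c)
    rw [ringKrullDim_eq_bot_of_subsingleton]
    exact WithBot.bot_lt_coe _
  suffices ringKrullDim (R ⧸ J) ≤ (n - 1 : ℕ) from
    this.trans_lt (by exact_mod_cast Nat.sub_lt hn one_pos)
  rw [ringKrullDim_quotient, Order.krullDim]
  refine iSup_le fun p ↦ ?_
  obtain ⟨c, hc, hcn⟩ := h p.head.1.asIdeal p.head.1.isPrime p.head.2
  let q : LTSeries (PrimeSpectrum R) := p.map Subtype.val fun _ _ h ↦ h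
  have hq : (q.length : ℕ∞) ≤ Order.coheight q.head := Order.length_le_coheight_head
  have : Nonempty (PrimeSpectrum R) := ⟨q.head⟩
  have hqR : Order.height q.head + Order.coheight q.head ≤ (N : ℕ∞) := by
    rw [ringKrullDim, Order.krullDim_eq_iSup_height_add_coheight_of_nonempty] at hR
    exact (le_iSup (fun a : PrimeSpectrum R ↦ Order.height a + Order.coheight a) q.head).trans
      (by exact_mod_cast hR)
  have hqP : p.head.1.asIdeal.height = Order.height q.head := by
    rw [PrimeSpectrum.height_eq_orderHeight]
    rfl
  rw [hqP] at hc
  have h1 : Order.height q.head + (q.length : ℕ∞) ≤ N := (add_le_add_right hq _).trans hqR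
  generalize Order.height q.head = a at h1 hc
  have hlen : q.length = p.length := rfl
  cases a with
  | top => simp at h1
  | coe a =>
    norm_cast at h1 hc ⊢
    omega

lemma map_jetSeries {A C ι : Type*} [CommRing A] [CommRing C] (f : A →+* C) {m : ℕ}
    (x : ι × Fin (m + 1) → A) (i : ι) : map f (jetSeries x i) = jetSeries (f ∘ x) i := by
  ext j
  rcases lt_or_ge j (m + 1) with hj | hj
  · simpa using (congrArg f (coeff_jetSeries x i ⟨j, hj⟩)).trans
      (coeff_jetSeries (f ∘ x) i ⟨j, hj⟩).symm
  · simp [coeff_jetSeries_of_le _ _ hj]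

lemma jetSeries_congr {A ι : Type*} [CommRing A] {m : ℕ} {x y : ι × Fin (m + 1) → A} {i : ι}
    (h : ∀ l, x (i, l) = y (i, l)) : jetSeries x i = jetSeries y i := by
  simp [jetSeries, h]

lemma exists_jetSeries_of_isUnit {A ι : Type*} [CommRing A] [Fintype ι] [DecidableEq ι] {m : ℕ}
    (d : ι → ℕ) (i : ι) (v : ι × Fin (m + 1) → A) (hv : ∑ j, v (j, 0) ^ d j = 0)
    (hu : IsUnit ((d i : A) * v (i, 0) ^ (d i - 1))) :
    ∃ w : ι × Fin (m + 1) → A, (∀ j l, j ≠ i → w (j, l) = v (j, l)) ∧ w (i, 0) = v (i, 0) ∧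
      X ^ (m + 1) ∣ ∑ j, jetSeries w j ^ d j := by
  obtain ⟨z, hz, hdvd⟩ := exists_X_pow_dvd_pow_add
    (∑ j ∈ Finset.univ.erase i, jetSeries v j ^ d j) (v (i, 0))
    (by rw [← hv, ← Finset.add_sum_erase _ _ (Finset.mem_univ i)]
        simp [constantCoeff_jetSeries]) hu (m + 1)
  let w : ι × Fin (m + 1) → A := fun a ↦ if a.1 = i then coeff (a.2 : ℕ) z else v a
  have hw : ∀ j l, j ≠ i → w (j, l) = v (j, l) := fun j l hj ↦ if_neg hj
  refine ⟨w, hw, by simp [w, hz], ?_⟩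
  rw [← Finset.add_sum_erase _ _ (Finset.mem_univ i), Finset.sum_congr rfl fun j hj ↦ by
    rw [jetSeries_congr fun l ↦ hw j l (Finset.ne_of_mem_erase hj)]]
  have hwz : X ^ (m + 1) ∣ jetSeries w i - z := by
    refine X_pow_dvd_iff.2 fun l hl ↦ ?_
    have := coeff_jetSeries w i ⟨l, hl⟩
    simp only [w, if_true] at this
    rw [map_sub, sub_eq_zero]
    exact this
  have := dvd_add (hwz.trans (sub_dvd_pow_sub_pow _ _ (d i))) hdvd
  convert this using 1
  ring

lemma eq_of_X_pow_dvd_sum_jetSeries {A ι : Type*} [CommRing A] [Fintype ι] [DecidableEq ι] {m : ℕ}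
    {d : ι → ℕ} {i : ι} {x y : ι × Fin (m + 1) → A}
    (hx : X ^ (m + 1) ∣ ∑ j, jetSeries x j ^ d j) (hy : X ^ (m + 1) ∣ ∑ j, jetSeries y j ^ d j)
    (hxy : ∀ j l, j ≠ i → x (j, l) = y (j, l)) (h0 : x (i, 0) = y (i, 0))
    (hu : IsUnit ((d i : A) * y (i, 0) ^ (d i - 1))) : x = y := by
  rw [← Finset.add_sum_erase _ _ (Finset.mem_univ i)] at hx hy
  rw [Finset.sum_congr rfl fun j hj ↦ by
    rw [jetSeries_congr fun l ↦ hxy j l (Finset.ne_of_mem_erase hj)]] at hx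
  have := X_pow_dvd_sub_of_pow_add hx hy (by simpa [constantCoeff_jetSeries] using h0)
    (by simpa [constantCoeff_jetSeries] using hu)
  ext ⟨j, l⟩
  rcases eq_or_ne j i with rfl | hj
  · have := X_pow_dvd_iff.1 this l l.2
    rwa [map_sub, sub_eq_zero, coeff_jetSeries, coeff_jetSeries] at this
  · exact hxy j l hj

/-- If the hypersurface `∑ X_j ^ d_j = 0` is integral, the closure of the set of its jets over the
open subset where `X_i` is invertible is irreducible. -/
lemma exists_isPrime_jetIdeal_le {k ι : Type*} [Field k] [Fintype ι] [DecidableEq ι] {d : ι → ℕ}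
    (hF : (Ideal.span {∑ i, MvPolynomial.X (R := k) i ^ d i}).IsPrime)
    (hX : ∀ j, MvPolynomial.X j ∉ Ideal.span {∑ i, MvPolynomial.X (R := k) i ^ d i})
    {i : ι} (hi : (d i : k) ≠ 0) (m : ℕ) :
    ∃ P : Ideal (MvPolynomial (ι × Fin (m + 1)) k), P.IsPrime ∧
      jetIdeal k ι m {∑ i, MvPolynomial.X i ^ d i} ≤ P ∧ (∀ j, MvPolynomial.X (j, 0) ∉ P) ∧
      ∀ Q : Ideal (MvPolynomial (ι × Fin (m + 1)) k), Q.IsPrime →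
        jetIdeal k ι m {∑ i, MvPolynomial.X i ^ d i} ≤ Q → MvPolynomial.X (i, 0) ∉ Q → P ≤ Q := by
  let J : Ideal (MvPolynomial ι k) := Ideal.span {∑ i, MvPolynomial.X i ^ d i}
  have : J.IsPrime := hF
  let b : ι → MvPolynomial ι k ⧸ J := fun j ↦ Ideal.Quotient.mk J (MvPolynomial.X j)
  have hb : ∀ j, b j ≠ 0 := fun j h ↦ hX j (Ideal.Quotient.eq_zero_iff_mem.1 h)
  have hbsum : ∑ j, b j ^ d j = 0 := by
    simp only [b, ← map_pow, ← map_sum]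
    exact Ideal.Quotient.eq_zero_iff_mem.2 (Ideal.mem_span_singleton_self _)
  let L := Localization.Away (b i)
  have hle : Submonoid.powers (b i) ≤ nonZeroDivisors _ :=
    powers_le_nonZeroDivisors_of_noZeroDivisors (hb i)
  have : IsDomain L := IsLocalization.isDomain_localization hle
  have hinj : Function.Injective (algebraMap (MvPolynomial ι k ⧸ J) L) :=
    IsLocalization.injective L hle
  let f : (MvPolynomial ι k ⧸ J) →+* MvPolynomial (ι × Fin (m + 1)) L :=
    MvPolynomial.C.comp (algebraMap (MvPolynomial ι k ⧸ J) L)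
  have hf : Function.Injective f := (MvPolynomial.C_injective _ _).comp hinj
  let v : ι × Fin (m + 1) → MvPolynomial (ι × Fin (m + 1)) L :=
    fun a ↦ if a.2 = 0 then f (b a.1) else MvPolynomial.X a
  have hv : ∀ j, v (j, 0) = f (b j) := fun j ↦ if_pos rfl
  obtain ⟨w, hw, hwi, hdvd⟩ := exists_jetSeries_of_isUnit d i v
    (by simp only [hv, ← map_pow, ← map_sum]; rw [hbsum, map_zero])
    (by
      rw [hv]
      refine IsUnit.mul ?_ (IsUnit.pow _ ?_)
      · have := (IsUnit.mk0 _ hi).map (algebraMap k (MvPolynomial (ι × Fin (m + 1)) L))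
        rwa [map_natCast] at this
      · exact (IsLocalization.Away.algebraMap_isUnit (b i)).map MvPolynomial.C)
  have hw0 : ∀ j, w (j, 0) = f (b j) := fun j ↦ by
    rcases eq_or_ne j i with rfl | hj
    · rw [hwi, hv]
    · rw [hw j 0 hj, hv]
  refine ⟨RingHom.ker (MvPolynomial.aeval (R := k) w), RingHom.ker_isPrime _,
    (jetIdeal_le_ker_aeval_iff d w).2 hdvd, fun j hj ↦ hb j ?_, fun Q hQ hIQ hiQ ↦ ?_⟩
  · rw [RingHom.mem_ker, MvPolynomial.aeval_X, hw0] at hj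
    exact hf (by rw [hj, map_zero])
  obtain ⟨K, _, _, x, rfl⟩ := MvPolynomial.exists_ker_aeval_eq Q
  have hx := (jetIdeal_le_ker_aeval_iff d x).1 hIQ
  have hxi : x (i, 0) ≠ 0 := by simpa [RingHom.mem_ker] using hiQ
  have hx0 : ∑ j, x (j, 0) ^ d j = 0 := by
    have := X_dvd_iff.1 ((dvd_pow_self X m.succ_ne_zero).trans hx)
    simpa [constantCoeff_jetSeries] using this
  let g : MvPolynomial ι k ⧸ J →+* K := Ideal.Quotient.lift J
    (MvPolynomial.aeval (R := k) fun j ↦ x (j, 0) : MvPolynomial ι k →ₐ[k] K).toRingHom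
    fun a ha ↦ by
      have : J ≤ RingHom.ker (MvPolynomial.aeval (R := k) fun j ↦ x (j, 0)) := by
        rw [Ideal.span_singleton_le_iff_mem, RingHom.mem_ker]
        simpa using hx0
      exact this ha
  have hg : ∀ j, g (b j) = x (j, 0) := fun j ↦ by simp [g, b]
  have hgu : IsUnit (g (b i)) := by rw [hg]; exact hxi.isUnit
  let ψ : MvPolynomial (ι × Fin (m + 1)) L →+* K :=
    MvPolynomial.eval₂Hom (IsLocalization.Away.lift (b i) hgu) x
  have hψf : ∀ a, ψ (f a) = g a := fun a ↦ by
    simp only [ψ, f, RingHom.comp_apply, MvPolynomial.coe_eval₂Hom, MvPolynomial.eval₂_C]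
    exact IsLocalization.Away.lift_eq _ hgu a
  have hψw : ψ ∘ w = x := by
    refine eq_of_X_pow_dvd_sum_jetSeries (i := i) ?_ hx (fun j l hj ↦ ?_) ?_ ?_
    · simpa [map_jetSeries] using map_dvd (map ψ) hdvd
    · by_cases hl : l = 0
      · subst hl
        simp [hw0, hψf, hg]
      · simp [hw j l hj, v, hl, ψ]
    · simp [hw0, hψf, hg]
    · refine (mul_ne_zero ?_ (pow_ne_zero _ hxi)).isUnit
      rw [← map_natCast (algebraMap k K)]
      exact (map_ne_zero _).2 hi
  have hcomp : ψ.comp (MvPolynomial.aeval (R := k) w).toRingHom =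
      (MvPolynomial.aeval (R := k) x).toRingHom := by
    refine MvPolynomial.ringHom_ext (fun a ↦ ?_) fun a ↦ ?_
    · have : (algebraMap k (MvPolynomial (ι × Fin (m + 1)) L)) a =
          f (Ideal.Quotient.mk J (MvPolynomial.C a)) := rfl
      simp [this, hψf, g]
    · simpa using congrFun hψw a
  intro a ha
  rw [RingHom.mem_ker] at ha ⊢
  have := RingHom.congr_fun hcomp a
  simp only [RingHom.comp_apply, AlgHom.toRingHom_eq_coe, RingHom.coe_coe] at this
  rw [← this, ha, map_zero]

section Fermat

variable {k ι : Type*} [Field k] [Fintype ι] [DecidableEq ι] {d : ι → ℕ}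

lemma ringKrullDim_quotient_jetFiberIdeal_lt (hd : ∀ i, d i ≠ 0)
    (han : ∀ p : ℕ, p.Prime → CharP k p →
      IsAnisotropicOn p (Finset.univ.filter fun i ↦ p ∣ d i) d)
    (hsum : 1 < ∑ i, (1 / d i : ℚ)) (m : ℕ) :
    ringKrullDim (MvPolynomial (ι × Fin (m + 1)) k ⧸
      jetFiberIdeal k ι m {∑ i, MvPolynomial.X i ^ d i} (fun _ ↦ 0)) <
        ((m + 1) * (Fintype.card ι - 1) : ℕ) := by
  refine ringKrullDim_quotient_lt (N := Fintype.card ι * (m + 1))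
    (by simp [MvPolynomial.ringKrullDim_of_isNoetherianRing]) _ fun P hP hJ ↦ ?_
  obtain ⟨c, hc, hc'⟩ := exists_card_le_height_add hd han hsum P (le_sup_left.trans hJ)
    fun i _ ↦ by
      have := hJ (le_sup_right (a := jetIdeal k ι m _) (Ideal.subset_span ⟨i, rfl⟩))
      simpa using this
  refine ⟨c, hc, ?_⟩
  rw [Nat.mul_sub_one, mul_comm (m + 1)]
  omega

lemma exists_X_notMem_of_mem_minimalPrimes_jetIdeal (hd : ∀ i, d i ≠ 0)
    (han : ∀ p : ℕ, p.Prime → CharP k p →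
      IsAnisotropicOn p (Finset.univ.filter fun i ↦ p ∣ d i) d)
    (hsum : 1 < ∑ i, (1 / d i : ℚ)) {m : ℕ} {P : Ideal (MvPolynomial (ι × Fin (m + 1)) k)}
    (hP : P ∈ (jetIdeal k ι m {∑ i, MvPolynomial.X i ^ d i}).minimalPrimes) :
    ∃ i, (d i : k) ≠ 0 ∧ MvPolynomial.X (i, 0) ∉ P := by
  by_contra! h0
  have := hP.1.1
  obtain ⟨c, hc, hc'⟩ := exists_card_le_height_add hd han hsum P hP.1.2 h0
  have hheight : P.height ≤ (m + 1 : ℕ) := by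
    classical
    let s := (Finset.range (m + 1)).image
      (jetSub k ι m (∑ i, MvPolynomial.X i ^ d i)).coeff
    have hs : (jetIdeal k ι m {∑ i, MvPolynomial.X i ^ d i}) = Ideal.span s := by
      rw [jetIdeal]
      congr 1
      ext g
      simp [s, eq_comm]
    rw [hs] at hP
    refine (Ideal.height_le_card_of_mem_minimalPrimes_span_finset hP).trans ?_
    exact_mod_cast Finset.card_image_le.trans (by simp)
  have := hc.trans (add_le_add_left hheight _)
  norm_cast at this
  omega

lemma isPrime_radical_jetIdeal (hd : ∀ i, d i ≠ 0)
    (han : ∀ p : ℕ, p.Prime → CharP k p →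
      IsAnisotropicOn p (Finset.univ.filter fun i ↦ p ∣ d i) d)
    (hsum : 1 < ∑ i, (1 / d i : ℚ)) (hι : 3 ≤ Fintype.card ι) (m : ℕ) :
    (jetIdeal k ι m {∑ i, MvPolynomial.X i ^ d i}).radical.IsPrime := by
  have hne : jetIdeal k ι m {∑ i, MvPolynomial.X i ^ d i} ≠ ⊤ := fun h ↦ by
    have := (jetIdeal_le_ker_aeval_iff (k := k) d (0 : ι × Fin (m + 1) → k)).2
      (by simp [jetSeries, hd])
    rw [h, top_le_iff] at this
    exact RingHom.ker_ne_top _ this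
  obtain ⟨P, hP⟩ := Ideal.nonempty_minimalPrimes hne
  obtain ⟨i, hi, hiP⟩ := exists_X_notMem_of_mem_minimalPrimes_jetIdeal hd han hsum hP
  have hirr := MvPolynomial.irreducible_sum_X_pow (k := k) hd hι hi
  have hF := (Ideal.span_singleton_prime hirr.ne_zero).2 hirr.prime
  have : Nontrivial ι := Fintype.one_lt_card_iff_nontrivial.1 (by omega)
  have hX : ∀ j, MvPolynomial.X j ∉ Ideal.span {∑ i, MvPolynomial.X (R := k) i ^ d i} :=
    fun j ↦ (exists_ne j).elim fun l hl ↦ MvPolynomial.X_notMem_span_sum_X_pow hd hirr hl.symm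
  obtain ⟨P₀, hP₀, hIP₀, hXP₀, hle₀⟩ := exists_isPrime_jetIdeal_le hF hX hi m
  have hrad : (jetIdeal k ι m {∑ i, MvPolynomial.X i ^ d i}).radical = P₀ := by
    refine le_antisymm (hP₀.radical_le_iff.2 hIP₀) ?_
    rw [← Ideal.sInf_minimalPrimes]
    refine le_sInf fun Q hQ ↦ ?_
    obtain ⟨l, hl, hlQ⟩ := exists_X_notMem_of_mem_minimalPrimes_jetIdeal hd han hsum hQ
    obtain ⟨P₁, hP₁, hIP₁, hXP₁, hle₁⟩ := exists_isPrime_jetIdeal_le hF hX hl m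
    exact (hle₀ P₁ hP₁ hIP₁ (hXP₁ i)).trans (hle₁ Q hQ.1.1 hQ.1.2 hlQ)
  rwa [hrad]

end Fermat

end Jets

/- STATEMENT 11: Let `F = X_1^{d_1} + … + X_n^{d_n}` (`n ≥ 3`), `Z = V(F) ⊂ 𝔸^n` smooth away
from the origin, and suppose `∑_i 1/d_i > 1` (equivalently `D < ∑_i D/d_i` with `D = ∏ d_i`).
Then for every `m ≥ 1` with `D ∣ m+1` the fiber of `Z_m` over the origin has dimension
`< (m+1)(n−1)`, and hence `Z_m` is irreducible for every `m ≥ 1`. -/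
theorem stmt11 (k : Type*) [Field k] (n : ℕ) (hn : 3 ≤ n)
    (d : Fin n → ℕ) (hd : ∀ i, 2 ≤ d i)
    (D : ℕ) (hD : D = ∏ i, d i)
    -- `Z` is smooth away from the origin:
    (hsm : ∀ x : Fin n → k,
      MvPolynomial.eval x (∑ i : Fin n, MvPolynomial.X i ^ d i) = 0 → x ≠ 0 →
        ∃ i : Fin n,
          MvPolynomial.eval x (MvPolynomial.pderiv i
            (∑ i : Fin n, MvPolynomial.X i ^ d i)) ≠ 0)
    -- `∑ 1/d_i > 1`:
    (hsum : D < ∑ i, D / d i) :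
    (∀ m : ℕ, 1 ≤ m → D ∣ m + 1 →
      ringKrullDim (MvPolynomial (Fin n × Fin (m + 1)) k ⧸
          jetFiberIdeal k (Fin n) m {∑ i : Fin n, MvPolynomial.X i ^ d i} (fun _ => 0)) <
        (((m + 1) * (n - 1) : ℕ) : WithBot (WithTop ℕ))) ∧
    (∀ m : ℕ, 1 ≤ m →
      (jetIdeal k (Fin n) m {∑ i : Fin n, MvPolynomial.X i ^ d i}).radical.IsPrime) := by
  subst hD
  have hd0 : ∀ i, d i ≠ 0 := fun i ↦ by have := hd i; omega
  have hsum' := one_lt_sum_one_div hd0 hsum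
  have han : ∀ p : ℕ, p.Prime → CharP k p →
      IsAnisotropicOn p (Finset.univ.filter fun i ↦ p ∣ d i) d := fun p hp _ ↦
    have : Fact p.Prime := ⟨hp⟩
    isAnisotropicOn_of_smooth hd hsm p
  refine ⟨fun m _ _ ↦ ?_, fun m _ ↦ isPrime_radical_jetIdeal hd0 han hsum' (by simpa using hn) m⟩
  have h := ringKrullDim_quotient_jetFiberIdeal_lt hd0 han hsum' m
  rw [Fintype.card_fin] at h
  exact h
end
end

section
/- Let X ⊂ A^{2n} (n ≥ 2) be the affine cone over the Segre embedding of P^1 × P^{n−1}, i.e., the variety of 2×n matrices of rank ≤ 1, defined by the 2×2 minors U_i V_j − U_j V_i. Then for every m ≥ 1, the fiber π_m^{-1}(0) of the m-th jet scheme over the origin is isomorphic to X_{m−2} × A^{2n} (with X_{-1} a point and X_0 = X). -/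
noncomputable section

/-- The `2 × 2` minors `U_i V_j − U_j V_i` of the generic `2 × n` matrix, cutting out the cone
over the Segre embedding of `ℙ¹ × ℙ^{n-1}` in `𝔸^{2n}`. -/
def segreMinors (k : Type*) [CommRing k] (n : ℕ) : Set (MvPolynomial (Fin 2 × Fin n) k) :=
  {g | ∃ i j : Fin n,
    g = MvPolynomial.X ((0 : Fin 2), i) * MvPolynomial.X ((1 : Fin 2), j) -
        MvPolynomial.X ((0 : Fin 2), j) * MvPolynomial.X ((1 : Fin 2), i)}

open Polynomial in
/-- Rescaling jets by `t` shifts the coefficients of a difference of products by two, and terms of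
order `m + 1` do not affect the coefficients of order at most `m`. -/
theorem coeff_mul_sub_mul_of_eq_X_mul {B : Type*} [CommRing B] {m l : ℕ} (hl : l ≤ m)
    {F a : Fin 4 → B[X]} {e : Fin 4 → B}
    (h : ∀ i, F i = X * (a i + C (e i) * X ^ (m + 1))) :
    (F 0 * F 1 - F 2 * F 3).coeff (l + 2) = (a 0 * a 1 - a 2 * a 3).coeff l := by
  have key : F 0 * F 1 - F 2 * F 3 = ((a 0 * a 1 - a 2 * a 3) +
      (a 0 * C (e 1) + a 1 * C (e 0) + C (e 0) * C (e 1) * X ^ (m + 1)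
        - (a 2 * C (e 3) + a 3 * C (e 2) + C (e 2) * C (e 3) * X ^ (m + 1)))
        * X ^ (m + 1)) * X ^ 2 := by
    simp only [h]
    ring
  rw [key, coeff_mul_X_pow, coeff_add, coeff_mul_X_pow', if_neg (by omega), add_zero]

open Polynomial in
theorem coeff_mul_sub_mul_eq_zero_of_lt_two {B : Type*} [CommRing B] {l : ℕ} (hl : l < 2)
    {F a : Fin 4 → B[X]} (h : ∀ i, F i = X * a i) :
    (F 0 * F 1 - F 2 * F 3).coeff l = 0 := by
  have key : F 0 * F 1 - F 2 * F 3 = (a 0 * a 1 - a 2 * a 3) * X ^ 2 := by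
    simp only [h]
    ring
  rw [key, coeff_mul_X_pow', if_neg (by omega)]

/-- The image of the universal `m`-jet under a homomorphism. -/
theorem map_jetSub_X {k σ B : Type*} [CommRing k] [CommRing B] {m : ℕ}
    (h : MvPolynomial (σ × Fin (m + 1)) k →+* B) (p : σ) :
    (jetSub k σ m (MvPolynomial.X p)).map h =
      ∑ j : Fin (m + 1), Polynomial.C (h (MvPolynomial.X (p, j))) * Polynomial.X ^ (j : ℕ) := by
  simp [jetSub, Polynomial.map_sum]

/-- The coefficients of the universal substitution in a minor, mapped to another ring. -/
theorem map_coeff_jetSub_minor {k σ B : Type*} [CommRing k] [CommRing B] {m : ℕ}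
    (h : MvPolynomial (σ × Fin (m + 1)) k →+* B) (p : Fin 4 → σ) (l : ℕ) :
    h ((jetSub k σ m (MvPolynomial.X (p 0) * MvPolynomial.X (p 1) -
        MvPolynomial.X (p 2) * MvPolynomial.X (p 3))).coeff l) =
      ((jetSub k σ m (MvPolynomial.X (p 0))).map h * (jetSub k σ m (MvPolynomial.X (p 1))).map h -
        (jetSub k σ m (MvPolynomial.X (p 2))).map h *
          (jetSub k σ m (MvPolynomial.X (p 3))).map h).coeff l := by
  rw [← Polynomial.coeff_map]
  simp

/-- A jet of order `m + 2` through the origin is `t` times a jet of order `m + 1`. -/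
theorem map_jetSub_X_eq_X_mul {k σ B : Type*} [CommRing k] [CommRing B] {m : ℕ}
    (h : MvPolynomial (σ × Fin (m + 2 + 1)) k →+* B)
    (g : MvPolynomial (σ × Fin (m + 1)) k →+* B)
    (h0 : ∀ i, h (MvPolynomial.X (i, 0)) = 0)
    (hg : ∀ i j, h (MvPolynomial.X (i, Fin.succ (Fin.castSucc j))) = g (MvPolynomial.X (i, j)))
    (i : σ) :
    (jetSub k σ (m + 2) (MvPolynomial.X i)).map h = Polynomial.X *
      ((jetSub k σ m (MvPolynomial.X i)).map g +
        Polynomial.C (h (MvPolynomial.X (i, (Fin.last (m + 1)).succ))) *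
          Polynomial.X ^ (m + 1)) := by
  rw [map_jetSub_X, map_jetSub_X, Fin.sum_univ_succ, Fin.sum_univ_castSucc]
  simp only [h0, hg, map_zero, zero_mul, zero_add, Fin.val_succ, Fin.val_castSucc, Fin.val_last,
    mul_add, Finset.mul_sum]
  congr 1
  · exact Finset.sum_congr rfl fun j _ => by ring
  · ring

theorem map_coeff_jetSub_minor_add_two {k σ B : Type*} [CommRing k] [CommRing B] {m l : ℕ}
    (hl : l ≤ m) (h : MvPolynomial (σ × Fin (m + 2 + 1)) k →+* B)
    (g : MvPolynomial (σ × Fin (m + 1)) k →+* B)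
    (h0 : ∀ i, h (MvPolynomial.X (i, 0)) = 0)
    (hg : ∀ i j, h (MvPolynomial.X (i, Fin.succ (Fin.castSucc j))) = g (MvPolynomial.X (i, j)))
    (p : Fin 4 → σ) :
    h ((jetSub k σ (m + 2) (MvPolynomial.X (p 0) * MvPolynomial.X (p 1) -
        MvPolynomial.X (p 2) * MvPolynomial.X (p 3))).coeff (l + 2)) =
      g ((jetSub k σ m (MvPolynomial.X (p 0) * MvPolynomial.X (p 1) -
        MvPolynomial.X (p 2) * MvPolynomial.X (p 3))).coeff l) := by
  rw [map_coeff_jetSub_minor, map_coeff_jetSub_minor]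
  exact coeff_mul_sub_mul_of_eq_X_mul hl
    (F := fun i => (jetSub k σ (m + 2) (MvPolynomial.X (p i))).map h)
    (a := fun i => (jetSub k σ m (MvPolynomial.X (p i))).map g)
    fun i => map_jetSub_X_eq_X_mul h g h0 hg (p i)

theorem map_coeff_jetSub_minor_of_lt_two {k σ B : Type*} [CommRing k] [CommRing B] {m l : ℕ}
    (hl : l < 2) (h : MvPolynomial (σ × Fin (m + 1)) k →+* B)
    (h0 : ∀ i, h (MvPolynomial.X (i, 0)) = 0) (p : Fin 4 → σ) :
    h ((jetSub k σ m (MvPolynomial.X (p 0) * MvPolynomial.X (p 1) -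
        MvPolynomial.X (p 2) * MvPolynomial.X (p 3))).coeff l) = 0 := by
  rw [map_coeff_jetSub_minor]
  have hX (i : σ) : ∃ a, (jetSub k σ m (MvPolynomial.X i)).map h = Polynomial.X * a := by
    refine ⟨∑ j : Fin m, Polynomial.C (h (MvPolynomial.X (i, j.succ))) *
      Polynomial.X ^ (j : ℕ), ?_⟩
    rw [map_jetSub_X, Fin.sum_univ_succ, Finset.mul_sum]
    simp only [h0, map_zero, zero_mul, zero_add, Fin.val_succ]
    exact Finset.sum_congr rfl fun j _ => by ring
  choose a ha using hX
  exact coeff_mul_sub_mul_eq_zero_of_lt_two hl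
    (F := fun i => (jetSub k σ m (MvPolynomial.X (p i))).map h)
    fun i => ha (p i)

theorem exists_eq_of_mem_segreMinors {k : Type*} [CommRing k] {n : ℕ}
    {f : MvPolynomial (Fin 2 × Fin n) k} (hf : f ∈ segreMinors k n) :
    ∃ p : Fin 4 → Fin 2 × Fin n, f = MvPolynomial.X (p 0) * MvPolynomial.X (p 1) -
        MvPolynomial.X (p 2) * MvPolynomial.X (p 3) := by
  obtain ⟨i, j, rfl⟩ := hf
  exact ⟨![(0, i), (1, j), (0, j), (1, i)], rfl⟩

theorem jetFiberIdeal_le_ker {k σ B : Type*} [CommRing k] [CommRing B] {m : ℕ}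
    {F : Set (MvPolynomial σ k)} (h : MvPolynomial (σ × Fin (m + 1)) k →+* B)
    (h0 : ∀ i, h (MvPolynomial.X (i, 0)) = 0)
    (hF : ∀ f ∈ F, ∀ l ≤ m, h ((jetSub k σ m f).coeff l) = 0) :
    jetFiberIdeal k σ m F (fun _ => 0) ≤ RingHom.ker h := by
  refine sup_le (Ideal.span_le.2 ?_) (Ideal.span_le.2 ?_)
  · rintro _ ⟨f, hf, l, hl, rfl⟩
    exact hF f hf l hl
  · rintro _ ⟨i, rfl⟩
    simp [RingHom.mem_ker, h0]

theorem mk_jetFiberIdeal_X_zero {k σ : Type*} [CommRing k] {m : ℕ}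
    {F : Set (MvPolynomial σ k)} (i : σ) :
    Ideal.Quotient.mk (jetFiberIdeal k σ m F (fun _ => 0)) (MvPolynomial.X (i, 0)) = 0 := by
  refine Ideal.Quotient.eq_zero_iff_mem.2 (Ideal.mem_sup_right (Ideal.subset_span ⟨i, ?_⟩))
  simp

theorem mk_jetFiberIdeal_coeff {k σ : Type*} [CommRing k] {m l : ℕ} (hl : l ≤ m)
    {F : Set (MvPolynomial σ k)} {x : σ → k} {f : MvPolynomial σ k} (hf : f ∈ F) :
    Ideal.Quotient.mk (jetFiberIdeal k σ m F x) ((jetSub k σ m f).coeff l) = 0 :=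
  Ideal.Quotient.eq_zero_iff_mem.2
    (Ideal.mem_sup_left (Ideal.subset_span ⟨f, hf, l, hl, rfl⟩))

/-- The fiber over the origin of the first jet scheme of the Segre cone is an affine space. -/
theorem nonempty_jetFiber_one_algEquiv (k : Type*) [CommRing k] (n : ℕ) :
    Nonempty ((MvPolynomial ((Fin 2 × Fin n) × Fin (1 + 1)) k ⧸
        jetFiberIdeal k (Fin 2 × Fin n) 1 (segreMinors k n) (fun _ => 0)) ≃ₐ[k]
      MvPolynomial (Fin 2 × Fin n) k) := by
  let φ₀ : MvPolynomial ((Fin 2 × Fin n) × Fin (1 + 1)) k →ₐ[k] MvPolynomial (Fin 2 × Fin n) k :=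
    MvPolynomial.aeval fun q => Fin.cases 0 (fun _ => MvPolynomial.X q.1) q.2
  have hφ0 (i) : φ₀ (MvPolynomial.X (i, 0)) = 0 := by simp [φ₀]
  have hφ1 (i) : φ₀ (MvPolynomial.X (i, Fin.succ 0)) = MvPolynomial.X i := by
    simp only [φ₀, MvPolynomial.aeval_X, Fin.cases_succ]
  have hφ : jetFiberIdeal k (Fin 2 × Fin n) 1 (segreMinors k n) (fun _ => 0) ≤
      RingHom.ker φ₀.toRingHom := by
    refine jetFiberIdeal_le_ker _ hφ0 fun f hf l hl => ?_
    obtain ⟨p, rfl⟩ := exists_eq_of_mem_segreMinors hf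
    exact map_coeff_jetSub_minor_of_lt_two (by omega) _ hφ0 p
  let φ := Ideal.Quotient.liftₐ _ φ₀ hφ
  let ψ : MvPolynomial (Fin 2 × Fin n) k →ₐ[k] (MvPolynomial ((Fin 2 × Fin n) × Fin (1 + 1)) k ⧸
        jetFiberIdeal k (Fin 2 × Fin n) 1 (segreMinors k n) (fun _ => 0)) :=
    MvPolynomial.aeval fun i => Ideal.Quotient.mk _ (MvPolynomial.X (i, Fin.succ 0))
  have hφmk (x) : φ (Ideal.Quotient.mk _ x) = φ₀ x := rfl
  have hψX (i) : ψ (MvPolynomial.X i) = Ideal.Quotient.mk _ (MvPolynomial.X (i, Fin.succ 0)) := by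
    simp only [ψ, MvPolynomial.aeval_X]
  refine ⟨AlgEquiv.ofAlgHom φ ψ ?_ ?_⟩
  · refine MvPolynomial.algHom_ext fun i => ?_
    rw [AlgHom.comp_apply, hψX, hφmk, hφ1, AlgHom.id_apply]
  · refine Ideal.Quotient.algHom_ext _ (MvPolynomial.algHom_ext fun ⟨i, j⟩ => ?_)
    change ψ (φ₀ (MvPolynomial.X (i, j))) = Ideal.Quotient.mk _ (MvPolynomial.X (i, j))
    refine Fin.cases ?_ (fun j => ?_) j
    · rw [hφ0, map_zero, mk_jetFiberIdeal_X_zero]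
    · rw [Subsingleton.elim j 0, hφ1, hψX]

/-- A jet of order `m + 2` through the origin lies on the Segre cone if the jet of order `m`
obtained by dividing it by `t` does. -/
theorem algHom_eq_zero_of_mem_jetFiberIdeal {k B : Type*} [CommRing k] [CommRing B] [Algebra k B]
    {n m : ℕ} (h : MvPolynomial ((Fin 2 × Fin n) × Fin (m + 2 + 1)) k →ₐ[k] B)
    (g : MvPolynomial ((Fin 2 × Fin n) × Fin (m + 1)) k →+* B)
    (h0 : ∀ i, h (MvPolynomial.X (i, 0)) = 0)
    (hg : ∀ i j, h (MvPolynomial.X (i, Fin.succ (Fin.castSucc j))) = g (MvPolynomial.X (i, j)))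
    (hJ : ∀ x ∈ jetIdeal k (Fin 2 × Fin n) m (segreMinors k n), g x = 0) :
    ∀ x ∈ jetFiberIdeal k (Fin 2 × Fin n) (m + 2) (segreMinors k n) (fun _ => 0), h x = 0 := by
  refine fun x hx => jetFiberIdeal_le_ker h.toRingHom h0 (fun f hf l hl => ?_) hx
  have hfJ (l) (hl : l ≤ m) : g ((jetSub k (Fin 2 × Fin n) m f).coeff l) = 0 :=
    hJ _ (Ideal.subset_span ⟨f, hf, l, hl, rfl⟩)
  obtain ⟨p, rfl⟩ := exists_eq_of_mem_segreMinors hf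
  obtain hl2 | ⟨l, rfl⟩ : l < 2 ∨ ∃ l', l = l' + 2 := by
    by_cases h : l < 2
    · exact Or.inl h
    · exact Or.inr ⟨l - 2, by omega⟩
  · exact map_coeff_jetSub_minor_of_lt_two hl2 _ h0 p
  · rw [map_coeff_jetSub_minor_add_two (by omega) h.toRingHom g h0 hg p, hfJ l (by omega)]

/-- Dividing by `t` a jet of order `m + 2` of the Segre cone through the origin gives a jet of
order `m` of the Segre cone. -/
theorem algHom_eq_zero_of_mem_jetIdeal {k B : Type*} [CommRing k] [CommRing B] [Algebra k B]
    {n m : ℕ} (h : MvPolynomial ((Fin 2 × Fin n) × Fin (m + 2 + 1)) k →+* B)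
    (g : MvPolynomial ((Fin 2 × Fin n) × Fin (m + 1)) k →ₐ[k] B)
    (h0 : ∀ i, h (MvPolynomial.X (i, 0)) = 0)
    (hg : ∀ i j, h (MvPolynomial.X (i, Fin.succ (Fin.castSucc j))) = g (MvPolynomial.X (i, j)))
    (hF : ∀ f ∈ segreMinors k n, ∀ l ≤ m + 2,
      h ((jetSub k (Fin 2 × Fin n) (m + 2) f).coeff l) = 0) :
    ∀ x ∈ jetIdeal k (Fin 2 × Fin n) m (segreMinors k n), g x = 0 := by
  suffices jetIdeal k (Fin 2 × Fin n) m (segreMinors k n) ≤ RingHom.ker g.toRingHom from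
    fun x hx => this hx
  refine Ideal.span_le.2 ?_
  rintro _ ⟨f, hf, l, hl, rfl⟩
  have hfI := hF f hf (l + 2) (Nat.add_le_add_right hl 2)
  obtain ⟨p, rfl⟩ := exists_eq_of_mem_segreMinors hf
  rwa [map_coeff_jetSub_minor_add_two hl h g.toRingHom h0 hg p] at hfI

/-- The fiber over the origin of the jet scheme of order `m + 2` of the Segre cone is the product
of an affine space with the jet scheme of order `m`. -/
theorem nonempty_jetFiber_add_two_algEquiv (k : Type*) [CommRing k] (n m : ℕ) :
    Nonempty ((MvPolynomial ((Fin 2 × Fin n) × Fin (m + 2 + 1)) k ⧸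
          jetFiberIdeal k (Fin 2 × Fin n) (m + 2) (segreMinors k n) (fun _ => 0)) ≃ₐ[k]
        MvPolynomial (Fin 2 × Fin n)
          (MvPolynomial ((Fin 2 × Fin n) × Fin (m + 1)) k ⧸
            jetIdeal k (Fin 2 × Fin n) m (segreMinors k n))) := by
  set I := jetFiberIdeal k (Fin 2 × Fin n) (m + 2) (segreMinors k n) (fun _ => 0)
  set J := jetIdeal k (Fin 2 × Fin n) m (segreMinors k n)
  obtain ⟨φ₀, hφ0, hφs, hφl⟩ : ∃ φ₀ : MvPolynomial ((Fin 2 × Fin n) × Fin (m + 2 + 1)) k →ₐ[k]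
        MvPolynomial (Fin 2 × Fin n) (MvPolynomial ((Fin 2 × Fin n) × Fin (m + 1)) k ⧸ J),
      (∀ i, φ₀ (MvPolynomial.X (i, 0)) = 0) ∧
      (∀ i (j : Fin (m + 1)), φ₀ (MvPolynomial.X (i, Fin.succ (Fin.castSucc j))) =
        MvPolynomial.C (Ideal.Quotient.mk J (MvPolynomial.X (i, j)))) ∧
      ∀ i, φ₀ (MvPolynomial.X (i, (Fin.last (m + 1)).succ)) = MvPolynomial.X i := by
    refine ⟨MvPolynomial.aeval fun q => Fin.cases 0 (fun j => Fin.lastCases (MvPolynomial.X q.1)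
      (fun j => MvPolynomial.C (Ideal.Quotient.mk J (MvPolynomial.X (q.1, j)))) j) q.2,
      fun i => ?_, fun i j => ?_, fun i => ?_⟩
    · rw [MvPolynomial.aeval_X, Fin.cases_zero]
    · rw [MvPolynomial.aeval_X, Fin.cases_succ, Fin.lastCases_castSucc]
    · rw [MvPolynomial.aeval_X, Fin.cases_succ, Fin.lastCases_last]
  have hφ : ∀ x ∈ I, φ₀ x = 0 :=
    algHom_eq_zero_of_mem_jetFiberIdeal (n := n) (m := m) (k := k)
      (B := MvPolynomial (Fin 2 × Fin n) (MvPolynomial ((Fin 2 × Fin n) × Fin (m + 1)) k ⧸ J))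
      φ₀ (MvPolynomial.C.comp (Ideal.Quotient.mk J)) hφ0 hφs
      fun x hx => by rw [RingHom.comp_apply, Ideal.Quotient.eq_zero_iff_mem.2 hx, map_zero]
  let φ : (MvPolynomial ((Fin 2 × Fin n) × Fin (m + 2 + 1)) k ⧸ I) →ₐ[k]
      MvPolynomial (Fin 2 × Fin n)
      (MvPolynomial ((Fin 2 × Fin n) × Fin (m + 1)) k ⧸ J) := Ideal.Quotient.liftₐ I φ₀ hφ
  let ψ₀ : MvPolynomial ((Fin 2 × Fin n) × Fin (m + 1)) k →ₐ[k]
      (MvPolynomial ((Fin 2 × Fin n) × Fin (m + 2 + 1)) k ⧸ I) :=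
    MvPolynomial.aeval fun q =>
      Ideal.Quotient.mk I (MvPolynomial.X (q.1, Fin.succ (Fin.castSucc q.2)))
  have hψ₀X (i j) : ψ₀ (MvPolynomial.X (i, j)) =
      Ideal.Quotient.mk I (MvPolynomial.X (i, Fin.succ (Fin.castSucc j))) := by
    simp only [ψ₀, MvPolynomial.aeval_X]
  have hψ₀ : ∀ x ∈ J, ψ₀ x = 0 :=
    algHom_eq_zero_of_mem_jetIdeal (Ideal.Quotient.mk I) ψ₀ mk_jetFiberIdeal_X_zero
      (fun i j => (hψ₀X i j).symm) fun f hf l hl => mk_jetFiberIdeal_coeff hl hf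
  let ψ : MvPolynomial (Fin 2 × Fin n)
      (MvPolynomial ((Fin 2 × Fin n) × Fin (m + 1)) k ⧸ J) →ₐ[k]
      (MvPolynomial ((Fin 2 × Fin n) × Fin (m + 2 + 1)) k ⧸ I) :=
    MvPolynomial.aevalTower (Ideal.Quotient.liftₐ J ψ₀ hψ₀)
      fun i => Ideal.Quotient.mk I (MvPolynomial.X (i, (Fin.last (m + 1)).succ))
  have hφmk (x) : φ (Ideal.Quotient.mk I x) = φ₀ x := rfl
  have hψX (i) : ψ (MvPolynomial.X i) =
      Ideal.Quotient.mk I (MvPolynomial.X (i, (Fin.last (m + 1)).succ)) :=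
    MvPolynomial.aevalTower_X _ _ i
  have hψC (x) : ψ (MvPolynomial.C (Ideal.Quotient.mk J x)) = ψ₀ x :=
    MvPolynomial.aevalTower_C _ _ _
  refine ⟨AlgEquiv.ofAlgHom φ ψ ?_ ?_⟩
  · refine MvPolynomial.algHom_ext' ?_ fun i => ?_
    · refine Ideal.Quotient.algHom_ext _ (MvPolynomial.algHom_ext fun ⟨i, j⟩ => ?_)
      change φ (ψ (MvPolynomial.C (Ideal.Quotient.mk J (MvPolynomial.X (i, j))))) =
        MvPolynomial.C (Ideal.Quotient.mk J (MvPolynomial.X (i, j)))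
      rw [hψC, hψ₀X, hφmk, hφs]
    · rw [AlgHom.comp_apply, hψX, hφmk, hφl, AlgHom.id_apply]
  · refine Ideal.Quotient.algHom_ext _ (MvPolynomial.algHom_ext fun ⟨i, j⟩ => ?_)
    change ψ (φ₀ (MvPolynomial.X (i, j))) = Ideal.Quotient.mk I (MvPolynomial.X (i, j))
    refine Fin.cases ?_ (fun j => Fin.lastCases ?_ (fun j => ?_) j) j
    · rw [hφ0, map_zero, mk_jetFiberIdeal_X_zero]
    · rw [hφl, hψX]
    · rw [hφs, hψC, hψ₀X]

/- STATEMENT 12: For the cone `X ⊂ 𝔸^{2n}` over the Segre embedding of `ℙ¹ × ℙ^{n−1}`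
(`n ≥ 2`), the fiber of the `m`-th jet scheme over the origin satisfies
`π_m^{-1}(0) ≅ X_{m-2} × 𝔸^{2n}` for every `m ≥ 1` (with `X_{-1}` a point), stated as
isomorphisms of coordinate rings:  `π_1^{-1}(0) ≅ 𝔸^{2n}`, and for `m ≥ 2` (written `m + 2`),
`π_{m+2}^{-1}(0) ≅ X_m × 𝔸^{2n}`. -/
theorem stmt12 (k : Type*) [Field k] [IsAlgClosed k] (n : ℕ) (hn : 2 ≤ n) :
    Nonempty ((MvPolynomial ((Fin 2 × Fin n) × Fin (1 + 1)) k ⧸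
        jetFiberIdeal k (Fin 2 × Fin n) 1 (segreMinors k n) (fun _ => 0)) ≃ₐ[k]
      MvPolynomial (Fin 2 × Fin n) k) ∧
    ∀ m : ℕ,
      Nonempty ((MvPolynomial ((Fin 2 × Fin n) × Fin (m + 2 + 1)) k ⧸
          jetFiberIdeal k (Fin 2 × Fin n) (m + 2) (segreMinors k n) (fun _ => 0)) ≃ₐ[k]
        MvPolynomial (Fin 2 × Fin n)
          (MvPolynomial ((Fin 2 × Fin n) × Fin (m + 1)) k ⧸
            jetIdeal k (Fin 2 × Fin n) m (segreMinors k n))) :=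
  ⟨nonempty_jetFiber_one_algEquiv k n, nonempty_jetFiber_add_two_algEquiv k n⟩
end
end

section
/- Let k be a field, f ∈ k[X_1,...,X_N] homogeneous of degree a (for the grading deg X_i = 1), and for j ≥ 1 let f_0^{(j)} = f^{(j)}(0, X', ..., X^{(j)}) ∈ k[X_i^{(l)} : 1 ≤ i ≤ N, 1 ≤ l ≤ pa] be the iterated derivative D^j(f) evaluated at X = 0, where D(X_i^{(l)}) = X_i^{(l+1)}. Order the variables by reverse lexicographic order with X_i^{(j)} < X_{i'}^{(j')} when j > j', or j = j' and i > i'. If m(X) = in(f) is the initial term of f, then in(f_0^{(ja)}) = m(X^{(j)}) for 1 ≤ j ≤ p; hence the ideal (f_0^{(ja)} : 1 ≤ j ≤ p) in k[X', ..., X^{(pa)}] has dimension paN − p. -/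
/- STATEMENT 16: Let `f ∈ k[X_1,…,X_N]` be homogeneous of degree `a`, and for `j ≥ 1` let
`f_0^{(j)} = (D^j f)(0, X', …, X^{(j)})` be the iterated derivative (`D X_i^{(l)} = X_i^{(l+1)}`)
with the level-0 variables set to `0`.  Order the variables reverse-lexicographically with
`X_i^{(j)} < X_{i'}^{(j')}` when `j > j'`, or `j = j'` and `i > i'`.  If `m(X) = in(f)` is the
initial monomial of `f`, then `in(f_0^{(ja)}) = m(X^{(j)})` for `1 ≤ j ≤ p`; hence the ideal
`(f_0^{(ja)} : 1 ≤ j ≤ p)` in `k[X', …, X^{(pa)}]` has dimension `paN − p`. -/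

noncomputable section

variable (k : Type*) [Field k] (N : ℕ)

/-- The derivation `D` with `D X_i^{(l)} = X_i^{(l+1)}` on `k[X^{(0)}, X^{(1)}, …]`. -/
def jetDer : Derivation k (MvPolynomial (Fin N × ℕ) k) (MvPolynomial (Fin N × ℕ) k) :=
  MvPolynomial.mkDerivation k fun q : Fin N × ℕ => MvPolynomial.X (q.1, q.2 + 1)

/-- Setting the level-0 variables `X^{(0)}` to zero. -/
def killLevelZero : MvPolynomial (Fin N × ℕ) k →ₐ[k] MvPolynomial (Fin N × ℕ) k :=
  MvPolynomial.aeval fun q : Fin N × ℕ =>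
    if q.2 = 0 then 0 else MvPolynomial.X q

/-- `f_0^{(j)}`, the `j`-th iterated derivative of `f` with `X^{(0)}` set to `0`. -/
def iterDerAtZero (f : MvPolynomial (Fin N) k) (j : ℕ) : MvPolynomial (Fin N × ℕ) k :=
  killLevelZero k N ((⇑(jetDer k N))^[j] (MvPolynomial.rename (fun i : Fin N => (i, 0)) f))

/-- `w` is a (strictly) smaller variable than `w'`: `X_i^{(j)} < X_{i'}^{(j')}` iff `j > j'`,
or `j = j'` and `i > i'`. -/
def varLT (w w' : Fin N × ℕ) : Prop :=
  w'.2 < w.2 ∨ (w.2 = w'.2 ∧ (w'.1 : ℕ) < (w.1 : ℕ))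

/-- Reverse lexicographic comparison of exponent vectors: `u <_{revlex} v` iff at the smallest
variable where they differ, `u` has the larger exponent. -/
def revLexLT (u v : (Fin N × ℕ) →₀ ℕ) : Prop :=
  ∃ w, v w < u w ∧ ∀ w', varLT N w' w → u w' = v w'

/-- `u` is the exponent of the initial term of `g` for the above reverse lexicographic order. -/
def IsInitialExpOf (u : (Fin N × ℕ) →₀ ℕ) (g : MvPolynomial (Fin N × ℕ) k) : Prop :=
  u ∈ g.support ∧ ∀ e ∈ g.support, e ≠ u → revLexLT N e u

/-- The analogous reverse lexicographic order on the base polynomial ring `k[X_1,…,X_N]`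
(all variables at level `0`): `δ` is the exponent of the initial term of `f`. -/
def IsBaseInitialExpOf (δ : Fin N →₀ ℕ) (f : MvPolynomial (Fin N) k) : Prop :=
  δ ∈ f.support ∧ ∀ e ∈ f.support, e ≠ δ →
    ∃ i : Fin N, δ i < e i ∧ ∀ i' : Fin N, (i : ℕ) < (i' : ℕ) → e i' = δ i'

/-- General Leibniz rule for iterates of a derivation. -/
theorem derivation_iterate_mul {R B : Type*} [CommRing R] [CommRing B] [Algebra R B]
    (D : Derivation R B B) (n : ℕ) (x y : B) :
    D^[n] (x * y) =
      ∑ ij ∈ Finset.HasAntidiagonal.antidiagonal n, n.choose ij.1 • (D^[ij.1] x * D^[ij.2] y) := by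
  induction n with
  | zero => simp
  | succ n ih =>
    rw [Finset.sum_antidiagonal_choose_succ_nsmul (fun i j => D^[i] x * D^[j] y) n]
    simp only [Function.iterate_succ_apply', ih, map_sum, map_nsmul, Derivation.leibniz,
      smul_add, Finset.sum_add_distrib, smul_eq_mul]
    congr 1
    refine Finset.sum_congr rfl fun ⟨i, j⟩ hij ↦ ?_
    rw [n.choose_symm_of_eq_add (Finset.HasAntidiagonal.mem_antidiagonal.1 hij).symm, mul_comm]

/-- The formal flow `b ↦ ∑ (Dⁿ b / n!) tⁿ` of a derivation `D`. -/
def Derivation.expAlgHom {K B : Type*} [Field K] [CharZero K] [CommRing B] [Algebra K B]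
    (D : Derivation K B B) : B →ₐ[K] PowerSeries B :=
  AlgHom.ofLinearMap
    { toFun := fun b => PowerSeries.mk fun n => ((n.factorial : K)⁻¹) • D^[n] b
      map_add' := fun x y => by
        ext n
        simp [iterate_map_add]
      map_smul' := fun c x => by
        ext n
        have h : D^[n] (c • x) = c • D^[n] x :=
          Function.Commute.iterate_left (f := D) (g := (c • ·)) (fun z => D.map_smul c z) n x
        simp [h, smul_comm c] }
    (by
      ext n
      cases n with
      | zero => simp
      | succ n =>
        have : D^[n] 0 = 0 := iterate_map_zero D n
        simp [PowerSeries.coeff_one, this])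
    (fun x y => by
      ext n
      simp only [LinearMap.coe_mk, AddHom.coe_mk, PowerSeries.coeff_mk, PowerSeries.coeff_mul]
      rw [derivation_iterate_mul, Finset.smul_sum]
      refine Finset.sum_congr rfl fun ⟨i, j⟩ hij ↦ ?_
      obtain rfl := Finset.HasAntidiagonal.mem_antidiagonal.1 hij
      dsimp only
      rw [smul_mul_smul_comm, ← Nat.cast_smul_eq_nsmul K, smul_smul]
      congr 1
      rw [Nat.cast_add_choose]
      have := (Nat.cast_ne_zero (R := K)).2 (Nat.factorial_ne_zero (i + j))
      field_simp)

theorem Derivation.coeff_expAlgHom {K B : Type*} [Field K] [CharZero K] [CommRing B] [Algebra K B]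
    (D : Derivation K B B) (b : B) (n : ℕ) :
    PowerSeries.coeff n (D.expAlgHom b) = ((n.factorial : K)⁻¹) • D^[n] b := by
  simp [Derivation.expAlgHom]

/-- The generic arc through the origin, transported along `y`. -/
def arcAtZero {B : Type*} [CommRing B] [Algebra k B] (y : Fin N × ℕ → B) (i : Fin N) :
    PowerSeries B :=
  PowerSeries.mk fun l => if l = 0 then 0 else ((l.factorial : k)⁻¹) • y (i, l)

theorem jetDer_iterate_X (i : Fin N) (l n : ℕ) :
    (jetDer k N)^[n] (MvPolynomial.X (i, l)) = MvPolynomial.X (i, l + n) := by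
  induction n with
  | zero => simp
  | succ n ih =>
    rw [Function.iterate_succ_apply', ih]
    simp [jetDer, add_assoc]

/-- Taylor expansion: `f_0^{(n)} / n!` is the `n`-th coefficient of `f` along the generic arc
through the origin. -/
theorem map_iterDerAtZero {B : Type*} [CommRing B] [Algebra k B] [CharZero k]
    (θ : MvPolynomial (Fin N × ℕ) k →ₐ[k] B) (f : MvPolynomial (Fin N) k) (n : ℕ) :
    θ (iterDerAtZero k N f n) = (n.factorial : k) •
      PowerSeries.coeff n
        (MvPolynomial.aeval (arcAtZero k N fun q => θ (MvPolynomial.X q)) f) := by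
  have key : ((PowerSeries.mapAlgHom (θ.comp (killLevelZero k N))).comp
      ((jetDer k N).expAlgHom.comp (MvPolynomial.rename fun i : Fin N => (i, 0)))) =
      MvPolynomial.aeval (arcAtZero k N fun q => θ (MvPolynomial.X q)) := by
    refine MvPolynomial.algHom_ext fun i => ?_
    ext l
    simp only [AlgHom.comp_apply, MvPolynomial.rename_X, MvPolynomial.aeval_X,
      PowerSeries.mapAlgHom_apply, PowerSeries.coeff_map, Derivation.coeff_expAlgHom,
      jetDer_iterate_X, arcAtZero, PowerSeries.coeff_mk]
    by_cases hl : l = 0 <;> simp [hl, killLevelZero]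
  rw [← key]
  simp only [AlgHom.comp_apply, PowerSeries.mapAlgHom_apply, PowerSeries.coeff_map,
    Derivation.coeff_expAlgHom, iterDerAtZero]
  have := (Nat.cast_ne_zero (R := k)).2 (Nat.factorial_ne_zero n)
  simp [smul_smul, this]

theorem MvPolynomial.IsHomogeneous.aeval_mul {R σ B : Type*} [CommSemiring R] [CommSemiring B]
    [Algebra R B] {f : MvPolynomial σ R} {a : ℕ} (hf : f.IsHomogeneous a) (s : B) (y : σ → B) :
    MvPolynomial.aeval (fun i => s * y i) f = s ^ a * MvPolynomial.aeval y f := by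
  rw [MvPolynomial.aeval_eq_eval₂Hom, MvPolynomial.coe_eval₂Hom, MvPolynomial.eval₂_eq,
    MvPolynomial.aeval_eq_eval₂Hom, MvPolynomial.coe_eval₂Hom, MvPolynomial.eval₂_eq,
    Finset.mul_sum]
  refine Finset.sum_congr rfl fun d hd => ?_
  have hd' := hf.degree_eq_sum_deg_support hd
  rw [hd']
  simp_rw [mul_pow]
  rw [Finset.prod_mul_distrib, Finset.prod_pow_eq_pow_sum]
  ring

theorem isWeightedHomogeneous_coeff_aeval {σ ι R M : Type*} [CommRing R] [AddCommMonoid M]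
    {w : σ → M} {α β : M} {f : MvPolynomial ι R} {a : ℕ} (hf : f.IsHomogeneous a)
    {P : ι → PowerSeries (MvPolynomial σ R)}
    (hP : ∀ i l, MvPolynomial.IsWeightedHomogeneous w (PowerSeries.coeff l (P i)) (α + l • β))
    (l : ℕ) :
    MvPolynomial.IsWeightedHomogeneous w
      (PowerSeries.coeff l (MvPolynomial.aeval P f)) (a • α + l • β) := by
  classical
  have hmul : ∀ {A B : PowerSeries (MvPolynomial σ R)} {m n : ℕ},
      (∀ l, MvPolynomial.IsWeightedHomogeneous w (PowerSeries.coeff l A) (m • α + l • β)) →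
      (∀ l, MvPolynomial.IsWeightedHomogeneous w (PowerSeries.coeff l B) (n • α + l • β)) →
      ∀ l, MvPolynomial.IsWeightedHomogeneous w (PowerSeries.coeff l (A * B))
        ((m + n) • α + l • β) := by
    intro A B m n hA hB l
    rw [PowerSeries.coeff_mul]
    refine MvPolynomial.IsWeightedHomogeneous.sum _ _ _ fun ⟨i, j⟩ hij => ?_
    obtain rfl := Finset.HasAntidiagonal.mem_antidiagonal.1 hij
    convert! (hA i).mul (hB j) using 1
    simp only [add_smul]
    abel
  have hone : ∀ l, MvPolynomial.IsWeightedHomogeneous w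
      (PowerSeries.coeff l (1 : PowerSeries (MvPolynomial σ R))) (0 • α + l • β) := by
    intro l
    rw [PowerSeries.coeff_one]
    split_ifs with h
    · simpa [h] using MvPolynomial.isWeightedHomogeneous_one R w
    · exact MvPolynomial.isWeightedHomogeneous_zero R w _
  have hpow : ∀ i n l, MvPolynomial.IsWeightedHomogeneous w
      (PowerSeries.coeff l (P i ^ n)) (n • α + l • β) := by
    intro i n
    induction n with
    | zero => simpa using hone
    | succ n ih =>
      rw [pow_succ]
      exact hmul ih (by simpa using hP i)
  have hprod : ∀ (s : Finset ι) (d : ι → ℕ) l, MvPolynomial.IsWeightedHomogeneous w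
      (PowerSeries.coeff l (∏ i ∈ s, P i ^ d i)) ((∑ i ∈ s, d i) • α + l • β) := by
    intro s d
    induction s using Finset.induction_on with
    | empty => simpa using hone
    | insert i s hi ih =>
      rw [Finset.prod_insert hi, Finset.sum_insert hi]
      exact hmul (hpow i _) ih
  rw [MvPolynomial.aeval_eq_eval₂Hom, MvPolynomial.coe_eval₂Hom, MvPolynomial.eval₂_eq, map_sum]
  refine MvPolynomial.IsWeightedHomogeneous.sum _ _ _ fun d hd => ?_
  rw [← Algebra.smul_def, LinearMap.map_smul_of_tower, hf.degree_eq_sum_deg_support hd]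
  exact (MvPolynomial.weightedHomogeneousSubmodule R w _).smul_mem _ (hprod _ _ _)

theorem Polynomial.height_eq_of_isMaximal {R : Type*} [CommRing R] [IsNoetherianRing R]
    [IsJacobsonRing R] {n : ℕ∞} (h : ∀ P : Ideal R, P.IsMaximal → P.height = n)
    (P : Ideal (Polynomial R)) [P.IsMaximal] : P.height = n + 1 := by
  have hp : (P.under R).IsMaximal := Polynomial.isMaximal_comap_C_of_isJacobsonRing P
  rw [Polynomial.height_eq_height_add_one (P.under R) P, h _ hp]

/-- Every maximal ideal of a polynomial ring in `n` variables over a field has height `n`. -/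
theorem MvPolynomial.height_eq_natCard_of_isMaximal (K : Type*) [Field K] (ι : Type*) [Finite ι] :
    ∀ P : Ideal (MvPolynomial ι K), P.IsMaximal → P.height = Nat.card ι := by
  induction ι using Finite.induction_empty_option with
  | of_equiv e H =>
    intro P hP
    have hM : (P.comap (renameEquiv K e).toRingEquiv).IsMaximal :=
      Ideal.comap_isMaximal_of_equiv _
    have := H _ hM
    rw [RingEquiv.height_comap] at this
    rw [this, Nat.card_congr e]
  | h_empty =>
    intro P hP
    have e := (isEmptyRingEquiv K PEmpty).toMulEquiv.isField (Field.toIsField K)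
    let _ := e.toField
    have : P = ⊥ := (Ideal.eq_bot_or_top P).resolve_right hP.ne_top
    simp [this]
  | @h_option α _ IH =>
    intro P hP
    let e := (optionEquivLeft K α).symm.toRingEquiv
    have hM : (P.comap e).IsMaximal := Ideal.comap_isMaximal_of_equiv _
    have h1 := Polynomial.height_eq_of_isMaximal IH (P.comap e)
    rw [RingEquiv.height_comap] at h1
    simp [h1]

theorem ringKrullDim_le_of_isIntegral (A B : Type*) [CommRing A] [CommRing B] [Algebra A B]
    [Algebra.IsIntegral A B] : ringKrullDim B ≤ ringKrullDim A := by
  refine Order.krullDim_le_of_strictMono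
    (PrimeSpectrum.comap (algebraMap A B)) fun I J hIJ => ?_
  rw [← PrimeSpectrum.asIdeal_lt_asIdeal] at hIJ ⊢
  obtain ⟨x, hxJ, hxI⟩ := SetLike.exists_of_lt hIJ
  exact Ideal.comap_lt_comap_of_integral_mem_sdiff hIJ.le ⟨hxJ, hxI⟩
    (Algebra.IsIntegral.isIntegral x)

open MvPolynomial in
attribute [local instance] MvPolynomial.gradedAlgebra in
/-- A graded quotient of a polynomial ring whose irrelevant ideal is, up to radical, generated by
linear forms `h t` has dimension at most the number of those forms. -/
theorem MvPolynomial.ringKrullDim_le_natCard_of_surjective {K σ τ A : Type*} [Field K] [Finite σ]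
    [Finite τ] [CommRing A] [Algebra K A] (q : MvPolynomial σ K →ₐ[K] A)
    (hq : Function.Surjective q) {I : Ideal (MvPolynomial σ K)} (hIq : ∀ r ∈ I, q r = 0)
    (hI : I.IsHomogeneous (homogeneousSubmodule σ K))
    (h : τ → MvPolynomial σ K) (hh : ∀ t, (h t).IsHomogeneous 1)
    (hrad : ∀ Q : Ideal (MvPolynomial σ K), Q.IsPrime → I ≤ Q → (∀ t, h t ∈ Q) →
      ∀ s, X s ∈ Q) :
    ringKrullDim A ≤ Nat.card τ := by
  classical
  have := Fintype.ofFinite τ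
  let 𝔪 : Ideal (MvPolynomial σ K) := Ideal.span (Set.range X)
  have hle : 𝔪 ≤ (I ⊔ Ideal.span (Set.range h)).radical := by
    rw [Ideal.span_le]
    rintro _ ⟨s, rfl⟩
    rw [SetLike.mem_coe, Ideal.radical_eq_sInf, Ideal.mem_sInf]
    rintro Q ⟨hQ, hQp⟩
    exact hrad Q hQp (le_sup_left.trans hQ)
      (fun t => hQ (Ideal.mem_sup_right (Ideal.subset_span ⟨t, rfl⟩))) s
  obtain ⟨d, hd⟩ := Ideal.exists_pow_le_of_le_radical_of_fg hle (IsNoetherian.noetherian 𝔪)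
  let φ : MvPolynomial τ K →ₐ[K] A :=
    q.comp (aeval h)
  let _ := φ.toRingHom.toAlgebra
  have hφ : ∀ t r, algebraMap (MvPolynomial τ K) A (X t) *
      q r = q (h t * r) := by
    intro t r
    change φ (X t) * _ = _
    simp [φ]
  let G : Set A :=
    (fun u : σ →₀ ℕ => q (monomial u 1)) '' {u | u.degree < d}
  let M : Submodule (MvPolynomial τ K) A := Submodule.span _ G
  have hM : ∀ e, ∀ r : MvPolynomial σ K, r.IsHomogeneous e → q r ∈ M := by
    intro e
    induction e using Nat.strong_induction_on with
    | _ e ih =>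
      intro r hr
      by_cases hed : e < d
      · rw [← support_sum_monomial_coeff r, map_sum]
        refine Submodule.sum_mem _ fun u hu => ?_
        have : q (monomial u (coeff u r)) =
            (C (coeff u r) : MvPolynomial τ K) • q (monomial u 1) := by
          rw [Algebra.smul_def]
          change _ = φ (C _) * _
          simp only [φ, AlgHom.comp_apply, aeval_C, ← map_mul,
            algebraMap_eq, C_mul_monomial, mul_one]
        rw [this]
        refine M.smul_mem _ (Submodule.subset_span ⟨u, ?_, rfl⟩)
        have := hr.degree_eq_sum_deg_support hu
        change u.degree < d
        rw [Finsupp.degree_apply, ← this]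
        exact hed
      · have hmem : r ∈ 𝔪 ^ d := by
          refine Ideal.pow_le_pow_right (not_lt.1 hed) ?_
          rw [Ideal.mem_span_pow_iff_exists_isHomogeneous]
          exact ⟨map C r, hr.map C, by rw [eval_map]; exact eval₂_eta r⟩
        obtain ⟨x, hx, y, hy, hxy⟩ := Submodule.mem_sup.1 (hd hmem)
        obtain ⟨c, rfl⟩ := (Submodule.mem_span_range_iff_exists_fun _).1 hy
        have hr' : r = homogeneousComponent e x +
            ∑ t, homogeneousComponent e (h t * c t) := by
          conv_lhs => rw [← homogeneousComponent_eq_self hr, ← hxy]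
          simp [map_add, map_sum, mul_comm]
        rw [hr', map_add, map_sum]
        refine M.add_mem ?_ (Submodule.sum_mem _ fun t _ => ?_)
        · rw [hIq _ (homogeneousComponent_mem_of_mem hI hx e)]
          exact M.zero_mem
        · cases e with
          | zero =>
            have : homogeneousComponent 0 (h t * c t) = 0 := by
              rw [← decomposition.decompose'_apply]
              exact DirectSum.coe_decompose_mul_of_left_mem_of_not_le (homogeneousSubmodule σ K)
                ((mem_homogeneousSubmodule 1 _).2 (hh t)) (by simp)
            rw [this, map_zero]
            exact M.zero_mem
          | succ e =>
            have : homogeneousComponent (e + 1) (h t * c t) =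
                h t * homogeneousComponent e (c t) := by
              rw [← decomposition.decompose'_apply, ← decomposition.decompose'_apply, add_comm e 1]
              exact DirectSum.coe_decompose_mul_add_of_left_mem (homogeneousSubmodule σ K)
                ((mem_homogeneousSubmodule 1 _).2 (hh t))
            rw [this, ← hφ, ← Algebra.smul_def]
            exact M.smul_mem _ (ih e (Nat.lt_succ_self e) _
              (homogeneousComponent_isHomogeneous _ _))
  have hfin : Module.Finite (MvPolynomial τ K) A := by
    have hG : G.Finite := ((Finsupp.finite_of_degree_le (σ := σ) d).subset
      fun u (hu : u.degree < d) => hu.le).image _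
    refine ⟨⟨hG.toFinset, ?_⟩⟩
    rw [Set.Finite.coe_toFinset]
    change M = ⊤
    rw [eq_top_iff]
    rintro x -
    obtain ⟨r, rfl⟩ := hq x
    rw [← sum_homogeneousComponent r, map_sum]
    exact Submodule.sum_mem _ fun e _ => hM e _ (homogeneousComponent_isHomogeneous _ _)
  have := Algebra.IsIntegral.of_finite (MvPolynomial τ K) A
  refine (ringKrullDim_le_of_isIntegral (MvPolynomial τ K) _).trans ?_
  simp [MvPolynomial.ringKrullDim_of_isNoetherianRing]

theorem coeff_killCompl {R σ τ : Type*} [CommSemiring R] {g : σ → τ} (hg : Function.Injective g)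
    (F : MvPolynomial τ R) (e : σ →₀ ℕ) :
    MvPolynomial.coeff e (MvPolynomial.killCompl hg F) =
      MvPolynomial.coeff (e.mapDomain g) F := by
  classical
  induction F using MvPolynomial.induction_on' with
  | add p q hp hq => simp [hp, hq]
  | monomial u r =>
    by_cases hu : (u.support : Set τ) ⊆ Set.range g
    · rw [MvPolynomial.killCompl_monomial_eq_monomial_comapDomain_of_subset hg r hu,
        MvPolynomial.coeff_monomial, MvPolynomial.coeff_monomial]
      have := Finsupp.mapDomain_comapDomain g hg u hu
      congr 1
      refine propext ⟨fun h => by rw [← h, this], fun h => ?_⟩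
      exact Finsupp.mapDomain_injective hg (by rw [this, h])
    · rw [MvPolynomial.killCompl_monomial_eq_zero_of_not_subset hg r hu,
        MvPolynomial.coeff_monomial, if_neg, MvPolynomial.coeff_zero]
      rintro rfl
      refine hu fun x hx => ?_
      obtain ⟨i, -, rfl⟩ := Finset.mem_image.1 (Finsupp.mapDomain_support hx)
      exact ⟨i, rfl⟩

theorem level_injective (j : ℕ) : Function.Injective fun i : Fin N => (i, j) :=
  fun _ _ h => (Prod.mk.inj h).1

variable {k N}

/-- The part of `f_0^{(ja)}` involving only level-`j` variables is a multiple of `f(X^{(j)})`. -/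
theorem coeff_mapDomain_iterDerAtZero [CharZero k] {f : MvPolynomial (Fin N) k} {a j : ℕ}
    (hf : f.IsHomogeneous a) (hj : 1 ≤ j) (e : Fin N →₀ ℕ) :
    MvPolynomial.coeff (e.mapDomain fun i => (i, j)) (iterDerAtZero k N f (j * a)) =
      ((j * a).factorial : k) * ((j.factorial : k)⁻¹) ^ a * MvPolynomial.coeff e f := by
  rw [← coeff_killCompl (level_injective N j), map_iterDerAtZero]
  have h1 : (arcAtZero k N fun q => MvPolynomial.killCompl (level_injective N j)
      (MvPolynomial.X q : MvPolynomial (Fin N × ℕ) k)) =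
      fun i => PowerSeries.monomial j (MvPolynomial.C (j.factorial : k)⁻¹) *
        PowerSeries.C (MvPolynomial.X i) := by
    funext i
    ext1 l
    rw [PowerSeries.coeff_mul_C, PowerSeries.coeff_monomial, arcAtZero, PowerSeries.coeff_mk]
    by_cases hl : l = j
    · subst hl
      have := MvPolynomial.killCompl_rename_app (level_injective N l)
        (MvPolynomial.X i : MvPolynomial (Fin N) k)
      rw [MvPolynomial.rename_X] at this
      rw [this, if_neg (by omega), if_pos rfl, MvPolynomial.smul_eq_C_mul]
    · have : MvPolynomial.killCompl (level_injective N j)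
          (MvPolynomial.X (i, l) : MvPolynomial (Fin N × ℕ) k) = 0 :=
        MvPolynomial.killCompl_monomial_eq_zero_of_notMem_range _ _
          (a := (i, l)) (by simp) (by simpa using Ne.symm hl)
      simp [this, hl]
  have h2 : MvPolynomial.aeval (fun i : Fin N => (PowerSeries.C (MvPolynomial.X i) :
      PowerSeries (MvPolynomial (Fin N) k))) f = PowerSeries.C f := by
    have := MvPolynomial.aeval_algebraMap_apply (PowerSeries (MvPolynomial (Fin N) k))
      (MvPolynomial.X : Fin N → MvPolynomial (Fin N) k) f
    rw [MvPolynomial.aeval_X_left_apply] at this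
    exact this
  rw [h1, hf.aeval_mul, h2, PowerSeries.coeff_mul_C, PowerSeries.monomial_pow,
    mul_comm a j, PowerSeries.coeff_monomial_same, ← map_pow, MvPolynomial.coeff_smul,
    MvPolynomial.coeff_C_mul, smul_eq_mul, mul_assoc]

theorem isWeightedHomogeneous_iterDerAtZero [CharZero k] {f : MvPolynomial (Fin N) k} {a : ℕ}
    (hf : f.IsHomogeneous a) (n : ℕ) {M : Type*} [AddCommMonoid M] (w : Fin N × ℕ → M) (α β : M)
    (hw : ∀ q, w q = α + q.2 • β) :
    MvPolynomial.IsWeightedHomogeneous w (iterDerAtZero k N f n) (a • α + n • β) := by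
  have := map_iterDerAtZero k N (AlgHom.id k _) f n
  rw [AlgHom.id_apply] at this
  rw [this]
  refine (MvPolynomial.weightedHomogeneousSubmodule k w _).smul_mem _
    (isWeightedHomogeneous_coeff_aeval hf (fun i l => ?_) n)
  rw [arcAtZero, PowerSeries.coeff_mk]
  split_ifs with h
  · exact MvPolynomial.isWeightedHomogeneous_zero _ _ _
  · refine (MvPolynomial.weightedHomogeneousSubmodule k w _).smul_mem _ ?_
    rw [← hw (i, l)]
    exact MvPolynomial.isWeightedHomogeneous_X k w (i, l)

theorem isInitialExpOf_iterDerAtZero [CharZero k] {f : MvPolynomial (Fin N) k} {a j : ℕ}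
    (hf : f.IsHomogeneous a) (hj : 1 ≤ j) {δ : Fin N →₀ ℕ} (hδ : IsBaseInitialExpOf k N δ f) :
    IsInitialExpOf k N (δ.mapDomain fun i : Fin N => (i, j)) (iterDerAtZero k N f (j * a)) := by
  have hinj := level_injective N j
  have hc : ((j * a).factorial : k) * ((j.factorial : k)⁻¹) ^ a ≠ 0 :=
    mul_ne_zero (Nat.cast_ne_zero.2 (Nat.factorial_ne_zero _))
      (pow_ne_zero _ (inv_ne_zero (Nat.cast_ne_zero.2 (Nat.factorial_ne_zero _))))
  have hzero : ∀ (e : Fin N →₀ ℕ) (q : Fin N × ℕ), q.2 ≠ j →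
      e.mapDomain (fun i : Fin N => (i, j)) q = 0 := by
    intro e q hq
    refine Finsupp.mapDomain_of_notMem_range _ _ ?_
    rintro ⟨i, rfl⟩
    exact hq rfl
  refine ⟨?_, fun u hu hne => ?_⟩
  · rw [MvPolynomial.mem_support_iff, coeff_mapDomain_iterDerAtZero hf hj]
    exact mul_ne_zero hc (MvPolynomial.mem_support_iff.1 hδ.1)
  by_cases hlev : ∀ q ∈ u.support, q.2 ≤ j
  · have hdeg := isWeightedHomogeneous_iterDerAtZero hf (j * a) (fun _ => 1) 1 0 (by simp)
      (MvPolynomial.mem_support_iff.1 hu)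
    have hwt := isWeightedHomogeneous_iterDerAtZero hf (j * a) (fun q => q.2) 0 1 (by simp)
      (MvPolynomial.mem_support_iff.1 hu)
    simp only [Finsupp.weight_apply, Finsupp.sum, smul_eq_mul, mul_one, mul_zero, add_zero,
      zero_add] at hdeg hwt
    have hall : ∀ q ∈ u.support, q.2 = j := by
      have hle : ∀ q ∈ u.support, u q * q.2 ≤ u q * j :=
        fun q hq => Nat.mul_le_mul_left _ (hlev q hq)
      have := (Finset.sum_eq_sum_iff_of_le hle).1
        (by rw [hwt, ← Finset.sum_mul, hdeg, mul_comm])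
      intro q hq
      exact Nat.eq_of_mul_eq_mul_left (Nat.pos_of_ne_zero (Finsupp.mem_support_iff.1 hq))
        (this q hq)
    obtain ⟨e, rfl⟩ : ∃ e : Fin N →₀ ℕ, e.mapDomain (fun i => (i, j)) = u :=
      ⟨_, Finsupp.mapDomain_comapDomain _ hinj u fun q hq => ⟨q.1, by rw [← hall q hq]⟩⟩
    rw [MvPolynomial.mem_support_iff, coeff_mapDomain_iterDerAtZero hf hj] at hu
    obtain ⟨i, hi, hi'⟩ := hδ.2 e
      (MvPolynomial.mem_support_iff.2 (right_ne_zero_of_mul hu)) (by rintro rfl; exact hne rfl)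
    have happ : ∀ (e : Fin N →₀ ℕ) i, e.mapDomain (fun i : Fin N => (i, j)) (i, j) = e i :=
      fun e i => Finsupp.mapDomain_apply hinj e i
    refine ⟨(i, j), by rwa [happ, happ], ?_⟩
    rintro ⟨i', l⟩ hlt
    by_cases hl : l = j
    · subst hl
      rw [happ, happ]
      rcases hlt with hlt | hlt
      · exact absurd hlt (lt_irrefl _)
      · exact hi' i' hlt.2
    · rw [hzero e _ hl, hzero δ _ hl]
  · push Not at hlev
    obtain ⟨q₀, hq₀, hlt₀⟩ := hlev
    obtain ⟨q, hq, hmax⟩ := u.support.exists_max_image (fun q => toLex (q.2, q.1)) ⟨q₀, hq₀⟩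
    have hqj : j < q.2 := by
      have := (Prod.Lex.le_iff.1 (hmax q₀ hq₀))
      simp at this
      omega
    refine ⟨q, ?_, fun q' hq' => ?_⟩
    · rw [hzero δ q hqj.ne']
      exact Nat.pos_of_ne_zero (Finsupp.mem_support_iff.1 hq)
    · have hne' : q'.2 ≠ j := by rcases hq' with h | h <;> omega
      rw [hzero δ _ hne']
      by_contra hcon
      have := Prod.Lex.le_iff.1 (hmax q' (Finsupp.mem_support_iff.2 hcon))
      simp only [ofLex_toLex] at this
      rcases hq' with h | h
      · omega
      · have : (q'.1 : ℕ) ≤ q.1 := by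
          rcases this with h' | h'
          · omega
          · exact h'.2
        omega

/-- If the coefficients of `t^{ja}` in `Y^a` vanish for `1 ≤ j ≤ p` and `Y` is a polynomial of
degree at most `p` with no constant term, then `Y = 0`. -/
theorem PowerSeries.eq_zero_of_coeff_pow_eq_zero {B : Type*} [CommRing B] [IsDomain B]
    (Y : PowerSeries B) {a p : ℕ} (h0 : PowerSeries.coeff 0 Y = 0)
    (hp : ∀ l, p < l → PowerSeries.coeff l Y = 0)
    (h : ∀ j, 1 ≤ j → j ≤ p → PowerSeries.coeff (j * a) (Y ^ a) = 0) : Y = 0 := by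
  by_contra hY
  have hc := PowerSeries.coeff_order hY
  set j := Y.order.toNat with hj
  have h1 : 1 ≤ j := by
    by_contra hlt
    exact hc (by rwa [show j = 0 by omega])
  have h2 : j ≤ p := by
    by_contra hlt
    exact hc (hp _ (not_le.1 hlt))
  refine PowerSeries.coeff_order (pow_ne_zero a hY) ?_
  rw [PowerSeries.order_pow]
  have : (a • Y.order).toNat = j * a := by
    rw [nsmul_eq_mul, ENat.toNat_mul, ENat.toNat_natCast, mul_comm]
  rw [this]
  exact h j h1 h2

variable (k N) in
/-- Restriction to the variables of levels `1, …, m`, the others being set to zero. -/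
def truncateLevels (m : ℕ) :
    MvPolynomial (Fin N × ℕ) k →ₐ[k] MvPolynomial (Fin N × Fin m) k :=
  MvPolynomial.aeval fun q : Fin N × ℕ =>
    if h : 1 ≤ q.2 ∧ q.2 ≤ m then
      MvPolynomial.X (q.1, (⟨q.2 - 1, by omega⟩ : Fin m))
    else 0

theorem truncateLevels_X_of_not_le {m : ℕ} (i : Fin N) {l : ℕ} (hl : ¬(1 ≤ l ∧ l ≤ m)) :
    truncateLevels k N m (MvPolynomial.X (i, l)) = 0 := by
  simp [truncateLevels, hl]

theorem truncateLevels_X_succ {m : ℕ} (i : Fin N) (t : Fin m) :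
    truncateLevels k N m (MvPolynomial.X (i, t + 1)) = MvPolynomial.X (i, t) := by
  have : (t : ℕ) + 1 ≤ m := t.2
  simp [truncateLevels, this]

theorem isHomogeneous_truncateLevels_iterDerAtZero [CharZero k] {f : MvPolynomial (Fin N) k}
    {a : ℕ} (hf : f.IsHomogeneous a) (m n : ℕ) :
    (truncateLevels k N m (iterDerAtZero k N f n)).IsHomogeneous a := by
  have h := isWeightedHomogeneous_iterDerAtZero hf n (fun _ => 1) 1 0 (by simp)
  have h' : (iterDerAtZero k N f n).IsHomogeneous a := by
    simpa [MvPolynomial.IsHomogeneous, Pi.one_def] using h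
  have := h'.aeval (n := 1) (S := k) (fun q : Fin N × ℕ =>
    if h : 1 ≤ q.2 ∧ q.2 ≤ m then
      MvPolynomial.X (q.1, (⟨q.2 - 1, by omega⟩ : Fin m))
    else 0) (fun q => by
      split_ifs
      · exact MvPolynomial.isHomogeneous_X _ _
      · exact MvPolynomial.isHomogeneous_zero _ _ _)
  rwa [one_mul] at this

theorem MvPolynomial.IsHomogeneous.aeval_zero_eq_zero {R σ : Type*} [CommSemiring R]
    {f : MvPolynomial σ R} {a : ℕ} (hf : f.IsHomogeneous a) (ha : 1 ≤ a) :
    MvPolynomial.aeval (fun _ => (0 : R)) f = 0 := by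
  have := hf.aeval_mul (0 : R) (fun _ => 0)
  simpa [zero_pow (show a ≠ 0 by omega)] using this

theorem MvPolynomial.IsHomogeneous.exists_aeval_ne_zero {K σ : Type*} [Field K] [Infinite K]
    {f : MvPolynomial σ K} {a : ℕ} (hf : f.IsHomogeneous a) (ha : 1 ≤ a) (h0 : f ≠ 0) :
    ∃ (c : σ → K) (i : σ), c i = 1 ∧ MvPolynomial.aeval c f ≠ 0 := by
  obtain ⟨c, hc⟩ : ∃ c : σ → K, MvPolynomial.aeval c f ≠ 0 := by
    by_contra! hcon
    exact h0 (MvPolynomial.funext fun x => by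
      rw [map_zero, ← hcon x, MvPolynomial.aeval_eq_eval])
  obtain ⟨i, hi⟩ : ∃ i, c i ≠ 0 := by
    by_contra! hcon
    rw [show c = fun _ => 0 from _root_.funext hcon] at hc
    exact hc (hf.aeval_zero_eq_zero ha)
  refine ⟨fun j => (c i)⁻¹ * c j, i, inv_mul_cancel₀ hi, ?_⟩
  rw [hf.aeval_mul]
  exact mul_ne_zero (pow_ne_zero _ (inv_ne_zero hi)) hc

/-- Along a line through the origin on which `f` does not vanish, the equations `f_0^{(ja)} = 0`
force the first `p` derivatives to vanish. -/
theorem arc_eq_zero_of_iterDerAtZero_eq_zero [CharZero k] {f : MvPolynomial (Fin N) k} {a p : ℕ}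
    (hf : f.IsHomogeneous a) {c : Fin N → k} (hc : MvPolynomial.aeval c f ≠ 0)
    {B : Type*} [CommRing B] [IsDomain B] [Algebra k B]
    (θ : MvPolynomial (Fin N × ℕ) k →ₐ[k] B) (y : ℕ → B)
    (hy : ∀ i l, 1 ≤ l → θ (MvPolynomial.X (i, l)) = c i • y l)
    (hyp : ∀ l, p < l → y l = 0)
    (h : ∀ j, 1 ≤ j → j ≤ p → θ (iterDerAtZero k N f (j * a)) = 0) (l : ℕ) (hl : 1 ≤ l) :
    y l = 0 := by
  have hfac : ∀ n : ℕ, ((n.factorial : k)) ≠ 0 :=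
    fun n => Nat.cast_ne_zero.2 (Nat.factorial_ne_zero n)
  let Y : PowerSeries B := PowerSeries.mk fun l =>
    if l = 0 then 0 else ((l.factorial : k)⁻¹) • y l
  have harc : (arcAtZero k N fun q => θ (MvPolynomial.X q)) =
      fun i => Y * algebraMap k (PowerSeries B) (c i) := by
    funext i
    rw [mul_comm, ← Algebra.smul_def]
    ext l
    rw [arcAtZero, PowerSeries.coeff_mk, LinearMap.map_smul_of_tower, PowerSeries.coeff_mk]
    split_ifs with hl
    · simp
    · rw [hy i l (by omega), smul_comm]
  have hY : Y = 0 := by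
    refine PowerSeries.eq_zero_of_coeff_pow_eq_zero Y (a := a) (p := p) (by simp [Y])
      (fun l hl => by simp [Y, hyp l hl]) fun j h1 h2 => ?_
    have := h j h1 h2
    rw [map_iterDerAtZero, harc, hf.aeval_mul, smul_eq_zero_iff_right (hfac _)] at this
    have hcf := MvPolynomial.aeval_algebraMap_apply (PowerSeries B) c f
    simp only [Function.comp_def] at hcf
    rw [hcf, mul_comm (Y ^ a), ← Algebra.smul_def, LinearMap.map_smul_of_tower,
      smul_eq_zero_iff_right hc] at this
    exact this
  have := congrArg (PowerSeries.coeff l) hY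
  rw [PowerSeries.coeff_mk, if_neg (by omega), map_zero,
    smul_eq_zero_iff_right (inv_ne_zero (hfac _))] at this
  exact this

/-- The generators `f_0^{(ja)}`, `1 ≤ j ≤ p`, in the variables of levels `1, …, m`. -/
def jetEquations (f : MvPolynomial (Fin N) k) (a p m : ℕ) :
    Set (MvPolynomial (Fin N × Fin m) k) :=
  {g | ∃ j : ℕ, 1 ≤ j ∧ j ≤ p ∧ g = truncateLevels k N m (iterDerAtZero k N f (j * a))}

theorem le_ringKrullDim_quotient_jetEquations [CharZero k] {f : MvPolynomial (Fin N) k} {a : ℕ}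
    (hf : f.IsHomogeneous a) (ha : 1 ≤ a) (p m : ℕ) :
    ((N * m : ℕ) : WithBot ℕ∞) ≤
      ringKrullDim (MvPolynomial (Fin N × Fin m) k ⧸ Ideal.span (jetEquations f a p m)) + p := by
  let ε : MvPolynomial (Fin N × Fin m) k →ₐ[k] k := MvPolynomial.aeval fun _ => 0
  have hε : (RingHom.ker ε).IsMaximal := RingHom.ker_isMaximal_of_surjective ε
    fun c => ⟨MvPolynomial.C c, by simp [ε]⟩
  have hsub : jetEquations f a p m ⊆ (RingHom.ker ε : Set _) := by
    rintro _ ⟨j, -, -, rfl⟩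
    exact (isHomogeneous_truncateLevels_iterDerAtZero hf m _).aeval_zero_eq_zero ha
  have hcard : (jetEquations f a p m).encard ≤ p := by
    have : jetEquations f a p m ⊆ (fun j => truncateLevels k N m (iterDerAtZero k N f (j * a))) ''
        (Finset.Icc 1 p : Set ℕ) := by
      rintro _ ⟨j, h1, h2, rfl⟩
      exact ⟨j, by simp [h1, h2], rfl⟩
    refine (Set.encard_le_encard this).trans ((Set.encard_image_le _ _).trans ?_)
    rw [Set.encard_coe_eq_coe_finsetCard]
    simp
  have hht := MvPolynomial.height_eq_natCard_of_isMaximal k (Fin N × Fin m) (RingHom.ker ε) hε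
  have := Ideal.height_le_ringKrullDim_quotient_add_encard _ hsub
  rw [hht] at this
  simp only [Nat.card_prod, Nat.card_fin] at this
  refine le_trans (by simp) (this.trans ?_)
  gcongr
  exact_mod_cast hcard

attribute [local instance] MvPolynomial.gradedAlgebra in
theorem ringKrullDim_quotient_jetEquations_le [CharZero k] {f : MvPolynomial (Fin N) k} {a : ℕ}
    (hf : f.IsHomogeneous a) (ha : 1 ≤ a) (h0 : f ≠ 0) {p m : ℕ} (hpm : p ≤ m) :
    ringKrullDim (MvPolynomial (Fin N × Fin m) k ⧸ Ideal.span (jetEquations f a p m)) ≤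
      ((N * m - p : ℕ) : WithBot ℕ∞) := by
  classical
  obtain ⟨c, i₀, hi₀, hc⟩ := hf.exists_aeval_ne_zero ha h0
  let S : Fin N × Fin m → Prop := fun q => q.1 = i₀ ∧ (q.2 : ℕ) < p
  let h : {q // ¬S q} → MvPolynomial (Fin N × Fin m) k := fun q =>
    if (q.1.2 : ℕ) < p then
      MvPolynomial.X q.1 - MvPolynomial.C (c q.1.1) * MvPolynomial.X (i₀, q.1.2)
    else MvPolynomial.X q.1
  have hh : ∀ t, (h t).IsHomogeneous 1 := by
    intro t
    dsimp only [h]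
    split_ifs
    · exact (MvPolynomial.isHomogeneous_X _ _).sub (MvPolynomial.isHomogeneous_C_mul_X _ _)
    · exact MvPolynomial.isHomogeneous_X _ _
  have hI : (Ideal.span (jetEquations f a p m)).IsHomogeneous
      (MvPolynomial.homogeneousSubmodule (Fin N × Fin m) k) := by
    refine Ideal.homogeneous_span _ _ ?_
    rintro _ ⟨j, -, -, rfl⟩
    exact ⟨a, isHomogeneous_truncateLevels_iterDerAtZero hf m _⟩
  have hcard : Nat.card {q // ¬S q} ≤ N * m - p := by
    have h1 : p ≤ Fintype.card {q // S q} := by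
      have := Fintype.card_le_of_injective
        (fun t : Fin p => (⟨(i₀, t.castLE hpm), rfl, t.2⟩ : {q // S q}))
        (fun s t hst => by simpa [Fin.ext_iff] using hst)
      simpa using this
    rw [Nat.card_eq_fintype_card, Fintype.card_subtype_compl]
    simp only [Fintype.card_prod, Fintype.card_fin]
    omega
  refine (MvPolynomial.ringKrullDim_le_natCard_of_surjective (Ideal.Quotient.mkₐ k _)
    (Ideal.Quotient.mkₐ_surjective k _) (fun r hr => Ideal.Quotient.eq_zero_iff_mem.2 hr)
    hI h hh ?_).trans (by exact_mod_cast hcard)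
  intro Q hQ hIQ hhQ s
  let θ := (Ideal.Quotient.mkₐ k Q).comp (truncateLevels k N m)
  have hmem : ∀ (i : Fin N) (t : Fin m), ¬ (t : ℕ) < p → MvPolynomial.X (i, t) ∈ Q := by
    intro i t ht
    have := hhQ ⟨(i, t), fun hS => ht hS.2⟩
    simpa only [h, if_neg ht] using this
  have hout : ∀ (i : Fin N) (l : ℕ), p < l → θ (MvPolynomial.X (i, l)) = 0 := by
    intro i l hl
    by_cases hlm : l ≤ m
    · obtain ⟨t, rfl⟩ : ∃ t : Fin m, l = t + 1 := ⟨⟨l - 1, by omega⟩, by simp; omega⟩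
      rw [AlgHom.comp_apply, truncateLevels_X_succ]
      exact Ideal.Quotient.eq_zero_iff_mem.2 (hmem i t (by omega))
    · rw [AlgHom.comp_apply, truncateLevels_X_of_not_le i (by omega), map_zero]
  have hline : ∀ (i : Fin N) (l : ℕ), 1 ≤ l →
      θ (MvPolynomial.X (i, l)) = c i • θ (MvPolynomial.X (i₀, l)) := by
    intro i l hl
    by_cases hlp : p < l
    · rw [hout i l hlp, hout i₀ l hlp, smul_zero]
    by_cases hi : i = i₀
    · rw [hi, hi₀, one_smul]
    obtain ⟨t, rfl⟩ : ∃ t : Fin m, l = t + 1 := ⟨⟨l - 1, by omega⟩, by simp; omega⟩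
    have := hhQ ⟨(i, t), fun hS => hi hS.1⟩
    simp only [h, if_pos (show (t : ℕ) < p by omega)] at this
    rw [← map_smul, AlgHom.comp_apply, AlgHom.comp_apply, map_smul, truncateLevels_X_succ,
      truncateLevels_X_succ, MvPolynomial.smul_eq_C_mul]
    exact Ideal.Quotient.eq.2 this
  have hy := arc_eq_zero_of_iterDerAtZero_eq_zero (p := p) hf hc θ
    (fun l => θ (MvPolynomial.X (i₀, l))) hline (hout i₀) fun j h1 h2 =>
      Ideal.Quotient.eq_zero_iff_mem.2 (hIQ (Ideal.subset_span ⟨j, h1, h2, rfl⟩))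
  have hs := hline s.1 (s.2 + 1) (by omega)
  rw [hy _ (by omega), smul_zero, AlgHom.comp_apply, truncateLevels_X_succ] at hs
  exact Ideal.Quotient.eq_zero_iff_mem.1 hs

theorem ringKrullDim_quotient_jetEquations [CharZero k] {f : MvPolynomial (Fin N) k} {a : ℕ}
    (hf : f.IsHomogeneous a) (ha : 1 ≤ a) (h0 : f ≠ 0) {p m : ℕ} (hpm : p ≤ m) :
    ringKrullDim (MvPolynomial (Fin N × Fin m) k ⧸ Ideal.span (jetEquations f a p m)) =
      ((N * m - p : ℕ) : WithBot ℕ∞) := by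
  refine le_antisymm (ringKrullDim_quotient_jetEquations_le hf ha h0 hpm) ?_
  have hle := le_ringKrullDim_quotient_jetEquations hf ha p m
  generalize ringKrullDim (MvPolynomial (Fin N × Fin m) k ⧸
    Ideal.span (jetEquations f a p m)) = d at hle ⊢
  generalize N * m = n at hle ⊢
  induction d with
  | bot => exact absurd (WithBot.bot_add (p : WithBot ℕ∞) ▸ hle) (not_le.2 (WithBot.bot_lt_coe _))
  | coe d =>
    induction d with
    | top => exact le_top
    | coe d =>
      norm_cast at hle
      exact WithBot.coe_le_coe.2 (Nat.cast_le.2 (by omega))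

variable (k N)

theorem stmt16 (a p : ℕ) (ha : 1 ≤ a) (hp : 1 ≤ p) [CharZero k]
    (f : MvPolynomial (Fin N) k) (hf : f ≠ 0)
    (hhom : MvPolynomial.IsHomogeneous f a)
    (δ : Fin N →₀ ℕ) (hδ : IsBaseInitialExpOf k N δ f) :
    -- `in(f_0^{(ja)}) = m(X^{(j)})` for `1 ≤ j ≤ p` …
    (∀ j : ℕ, 1 ≤ j → j ≤ p →
      IsInitialExpOf k N (δ.mapDomain fun i : Fin N => (i, j))
        (iterDerAtZero k N f (j * a))) ∧
    -- … hence the ideal `(f_0^{(ja)} : 1 ≤ j ≤ p) ⊆ k[X^{(1)},…,X^{(pa)}]` has dimension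
    -- `paN − p`:
    ringKrullDim (MvPolynomial (Fin N × Fin (p * a)) k ⧸
        Ideal.span {g : MvPolynomial (Fin N × Fin (p * a)) k | ∃ j : ℕ, 1 ≤ j ∧ j ≤ p ∧
          g = MvPolynomial.aeval (R := k)
            (fun q : Fin N × ℕ =>
              if h : 1 ≤ q.2 ∧ q.2 ≤ p * a then
                MvPolynomial.X (q.1, (⟨q.2 - 1, by omega⟩ : Fin (p * a)))
              else 0)
            (iterDerAtZero k N f (j * a))}) =
      ((p * a * N - p : ℕ) : WithBot (WithTop ℕ)) := by
  have hpm : p ≤ p * a := Nat.le_mul_of_pos_right p ha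
  refine ⟨fun j hj _ => isInitialExpOf_iterDerAtZero hhom hj hδ, ?_⟩
  rw [mul_comm (p * a) N]
  exact ringKrullDim_quotient_jetEquations hhom ha hf hpm

end
end
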